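/- For every integer m ≥ 2, the algebra Λ(m) over an algebraically closed field k is τ-tilting finite. -/

import Mathlib

open MulOpposite CategoryTheory CategoryTheory.Limits

noncomputable section

/-- A submodule `N ≤ M` is superfluous if `N ⊔ K = ⊤` implies `K = ⊤`. -/
def SuperfluousSubmodule {R M : Type} [Ring R] [AddCommGroup M] [Module R M]
    (N : Submodule R M) : Prop :=
  ∀ K : Submodule R M, N ⊔ K = ⊤ → K = ⊤

section TauTilting

variable (k : Type) [Field k]
variable (B : Type) [Ring B] [Algebra k B]

/-- A minimal projective presentation `P1 → P0 → M → 0` of a right `B`-module `M`. -/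
def IsMinimalProjPresentation (M P1 P0 : ModuleCat.{0} Bᵐᵒᵖ)
    (f : P1 →ₗ[Bᵐᵒᵖ] P0) (g : P0 →ₗ[Bᵐᵒᵖ] M) : Prop :=
  Module.Projective Bᵐᵒᵖ P1 ∧ Module.Projective Bᵐᵒᵖ P0 ∧
    Function.Surjective g ∧ LinearMap.range f = LinearMap.ker g ∧
    SuperfluousSubmodule (LinearMap.ker g) ∧ SuperfluousSubmodule (LinearMap.ker f)

/-- Left multiplication by `b` on the left `B`-module `Hom_B(P, B)` of a right module `P`. -/
def leftMulHom {P : Type} [AddCommGroup P] [Module Bᵐᵒᵖ P] (b : B)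
    (h : P →ₗ[Bᵐᵒᵖ] B) : P →ₗ[Bᵐᵒᵖ] B where
  toFun p := b * h p
  map_add' x y := by simp [mul_add]
  map_smul' r p := by
    simp only [map_smul, RingHom.id_apply]
    rw [MulOpposite.smul_eq_mul_unop, MulOpposite.smul_eq_mul_unop, mul_assoc]

/-- `M` is τ-rigid:  `Hom_B(M, τM) = 0`, where `τM = D(Tr M)` is computed from a minimal
projective presentation `P1 --f--> P0 → M → 0`, `Tr M = coker(Hom(P0,B) → Hom(P1,B))`, and
`D = Hom_k(-, k)`.  A right-module map `M → D(Tr M)` is encoded as an additive map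
`β : M →+ Hom_k(Hom_B(P1, B), k)` which is balanced (`β (m·b) = β m (b·-)`) and vanishes on
the image of `Hom(P0,B)`, i.e. descends to the cokernel `Tr M`. -/
def IsTauRigid (M : ModuleCat.{0} Bᵐᵒᵖ) : Prop :=
  ∀ (P1 P0 : ModuleCat.{0} Bᵐᵒᵖ) (f : P1 →ₗ[Bᵐᵒᵖ] P0) (g : P0 →ₗ[Bᵐᵒᵖ] M),
    IsMinimalProjPresentation B M P1 P0 f g →
    ∀ β : M →+ ((P1 →ₗ[Bᵐᵒᵖ] B) →ₗ[k] k),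
      (∀ (m : M) (b : B) (h : P1 →ₗ[Bᵐᵒᵖ] B),
        β (op b • m) h = β m (leftMulHom B b h)) →
      (∀ (m : M) (g0 : P0 →ₗ[Bᵐᵒᵖ] B), β m (g0.comp f) = 0) →
      β = 0

/-- A module is indecomposable if it is nonzero and admits no nontrivial direct sum
decomposition. -/
def IndecomposableMod (M : ModuleCat.{0} Bᵐᵒᵖ) : Prop :=
  Nontrivial M ∧ ∀ (L L' : ModuleCat.{0} Bᵐᵒᵖ),
    Nonempty (M ≃ₗ[Bᵐᵒᵖ] (L × L')) → Subsingleton L ∨ Subsingleton L'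

/-- A module is basic (multiplicity-free) if it has no repeated direct summand. -/
def IsBasicMod (M : ModuleCat.{0} Bᵐᵒᵖ) : Prop :=
  ∀ (L C : ModuleCat.{0} Bᵐᵒᵖ),
    Nonempty (M ≃ₗ[Bᵐᵒᵖ] (L × L × C)) → Subsingleton L

/-- `L` is an indecomposable direct summand of `M`. -/
def IsIndecSummand (L M : ModuleCat.{0} Bᵐᵒᵖ) : Prop :=
  IndecomposableMod B L ∧ ∃ L' : ModuleCat.{0} Bᵐᵒᵖ, Nonempty (M ≃ₗ[Bᵐᵒᵖ] (L × L'))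

/-- The rank of the Grothendieck group `K_0(B)` is `n`, i.e. there are exactly `n`
isomorphism classes of simple right `B`-modules. -/
def RankK0Is (n : ℕ) : Prop :=
  ∃ S : Fin n → ModuleCat.{0} Bᵐᵒᵖ,
    (∀ i, IsSimpleModule Bᵐᵒᵖ (S i)) ∧
    (∀ i j, i ≠ j → IsEmpty ((S i) ≃ₗ[Bᵐᵒᵖ] (S j))) ∧
    (∀ T : ModuleCat.{0} Bᵐᵒᵖ, IsSimpleModule Bᵐᵒᵖ T → ∃ i, Nonempty (T ≃ₗ[Bᵐᵒᵖ] S i))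

/-- The number of isomorphism classes of indecomposable direct summands of `M` is `n`. -/
def NumIndecSummandsIs (M : ModuleCat.{0} Bᵐᵒᵖ) (n : ℕ) : Prop :=
  ∃ N : Fin n → ModuleCat.{0} Bᵐᵒᵖ,
    (∀ i, IsIndecSummand B (N i) M) ∧
    (∀ i j, i ≠ j → IsEmpty ((N i) ≃ₗ[Bᵐᵒᵖ] (N j))) ∧
    (∀ L, IsIndecSummand B L M → ∃ i, Nonempty (L ≃ₗ[Bᵐᵒᵖ] N i))

/-- `M` is a τ-tilting module over `B`: it is a finitely generated τ-rigid module whose number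
of non-isomorphic indecomposable direct summands equals the rank of `K_0(B)`. -/
def IsTauTiltingMod (M : ModuleCat.{0} Bᵐᵒᵖ) : Prop :=
  Module.Finite Bᵐᵒᵖ M ∧ IsTauRigid k B M ∧
    ∃ n : ℕ, NumIndecSummandsIs B M n ∧ RankK0Is B n

end TauTilting

section Support

variable (k : Type) [Field k]
variable (A : Type) [Ring A] [Algebra k A]

/-- The quotient of `A` by the two-sided ideal `AeA` generated by `e`. -/
def IdemQuot (e : A) : Type := ((TwoSidedIdeal.span {e}).ringCon).Quotient

instance (e : A) : Ring (IdemQuot A e) :=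
  inferInstanceAs (Ring ((TwoSidedIdeal.span {e}).ringCon).Quotient)

/-- The quotient map `A → A/AeA`. -/
def IdemQuot.mk (e : A) : A →+* IdemQuot A e := RingCon.mk' _

instance (e : A) : Algebra k (IdemQuot A e) :=
  RingHom.toAlgebra' ((IdemQuot.mk A e).comp (algebraMap k A)) (by
    intro c x
    induction x using Quotient.ind with
    | _ a =>
      show (IdemQuot.mk A e) (algebraMap k A c) * (IdemQuot.mk A e) a
          = (IdemQuot.mk A e) a * (IdemQuot.mk A e) (algebraMap k A c)
      rw [← map_mul, ← map_mul, Algebra.commutes])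

/-- `M` is a support τ-tilting module over `A`: there is an idempotent `e ∈ A` such that `M` is
(the restriction of) a τ-tilting module over `A/AeA`. -/
def IsSupportTauTilting (M : ModuleCat.{0} Aᵐᵒᵖ) : Prop :=
  ∃ e : A, IsIdempotentElem e ∧
    ∃ N : ModuleCat.{0} (IdemQuot A e)ᵐᵒᵖ,
      IsTauTiltingMod k (IdemQuot A e) N ∧
      letI : Module Aᵐᵒᵖ N := Module.compHom N (RingHom.op (IdemQuot.mk A e))
      Nonempty (M ≃ₛₗ[RingHom.id Aᵐᵒᵖ] N)

/-- `A` is τ-tilting finite: it admits only finitely many basic support τ-tilting modules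
up to isomorphism. -/
def TauTiltingFinite : Prop :=
  ∃ (n : ℕ) (R : Fin n → ModuleCat.{0} Aᵐᵒᵖ),
    ∀ M : ModuleCat.{0} Aᵐᵒᵖ, IsSupportTauTilting k A M → IsBasicMod A M →
      ∃ i, Nonempty (M ≃ₗ[Aᵐᵒᵖ] R i)

/-- `A` is representation-finite: it has only finitely many isomorphism classes of finitely
generated indecomposable right modules. -/
def RepresentationFinite : Prop :=
  ∃ (n : ℕ) (R : Fin n → ModuleCat.{0} Aᵐᵒᵖ),
    ∀ M : ModuleCat.{0} Aᵐᵒᵖ, Module.Finite Aᵐᵒᵖ M → IndecomposableMod A M →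
      ∃ i, Nonempty (M ≃ₗ[Aᵐᵒᵖ] R i)

end Support

section QuiverAlg
variable (k : Type) [Field k]

/-- The product in the path algebra of a word of arrows (paths are composed from left to
right, so the path `α₁α₂` corresponds to the product `α₁ * α₂`). -/
def arrWord {V E : Type} (l : List E) : FreeAlgebra k (V ⊕ E) :=
  (l.map (fun a => FreeAlgebra.ι k (Sum.inr a))).prod

/-- The defining relations of a bound quiver algebra `kQ/I`: the vertices `e_v` are orthogonal
idempotents summing to `1`, each arrow `a : u → v` satisfies `e_u a = a = a e_v`, and the
extra relations generating the admissible ideal `I` hold. -/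
def quivRel {V E : Type} [Fintype V] [DecidableEq V] (s t : E → V)
    (extra : FreeAlgebra k (V ⊕ E) → FreeAlgebra k (V ⊕ E) → Prop) :
    FreeAlgebra k (V ⊕ E) → FreeAlgebra k (V ⊕ E) → Prop := fun x y =>
  (∃ v w : V, x = FreeAlgebra.ι k (Sum.inl v) * FreeAlgebra.ι k (Sum.inl w) ∧
    y = if v = w then FreeAlgebra.ι k (Sum.inl v) else 0) ∨
  (x = ∑ v : V, FreeAlgebra.ι k (Sum.inl v) ∧ y = 1) ∨
  (∃ a : E, x = FreeAlgebra.ι k (Sum.inl (s a)) * FreeAlgebra.ι k (Sum.inr a) ∧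
    y = FreeAlgebra.ι k (Sum.inr a)) ∨
  (∃ a : E, x = FreeAlgebra.ι k (Sum.inr a) * FreeAlgebra.ι k (Sum.inl (t a)) ∧
    y = FreeAlgebra.ι k (Sum.inr a)) ∨
  extra x y

/-- The bound quiver algebra presented by a quiver `(V, E, s, t)` and extra relations. -/
def BoundQuiverAlg {V E : Type} [Fintype V] [DecidableEq V] (s t : E → V)
    (extra : FreeAlgebra k (V ⊕ E) → FreeAlgebra k (V ⊕ E) → Prop) : Type :=
  RingQuot (quivRel k s t extra)

instance {V E : Type} [Fintype V] [DecidableEq V] (s t : E → V)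
    (extra : FreeAlgebra k (V ⊕ E) → FreeAlgebra k (V ⊕ E) → Prop) :
    Ring (BoundQuiverAlg k s t extra) :=
  inferInstanceAs (Ring (RingQuot (quivRel k s t extra)))

instance {V E : Type} [Fintype V] [DecidableEq V] (s t : E → V)
    (extra : FreeAlgebra k (V ⊕ E) → FreeAlgebra k (V ⊕ E) → Prop) :
    Algebra k (BoundQuiverAlg k s t extra) :=
  inferInstanceAs (Algebra k (RingQuot (quivRel k s t extra)))

end QuiverAlg

section QuiverAlg
variable (k : Type) [Field k]

/-! ### The quiver `Δ(p,q)`: two oriented cycles of lengths `p` and `q` glued at a vertex `0` -/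

/-- Vertices of `Δ(p,q)`: `none` is the common vertex `0`. -/
def CycV (p q : ℕ) : Type := Option ({i : ZMod p // i ≠ 0} ⊕ {j : ZMod q // j ≠ 0})

/-- The vertex of the `α`-cycle with index `i`. -/
def cycVL (p q : ℕ) (i : ZMod p) : CycV p q :=
  if h : i = 0 then none else some (Sum.inl ⟨i, h⟩)

/-- The vertex of the `β`-cycle with index `j`. -/
def cycVR (p q : ℕ) (j : ZMod q) : CycV p q :=
  if h : j = 0 then none else some (Sum.inr ⟨j, h⟩)

instance (p q : ℕ) : DecidableEq (CycV p q) :=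
  inferInstanceAs (DecidableEq (Option ({i : ZMod p // i ≠ 0} ⊕ {j : ZMod q // j ≠ 0})))

instance (p q : ℕ) [NeZero p] [NeZero q] : Fintype (CycV p q) :=
  inferInstanceAs (Fintype (Option ({i : ZMod p // i ≠ 0} ⊕ {j : ZMod q // j ≠ 0})))

/-- Arrows of `Δ(p,q)`: `Sum.inl i` is the arrow `α_{i+1}`, `Sum.inr j` is `β_{j+1}`. -/
def CycE (p q : ℕ) : Type := ZMod p ⊕ ZMod q

def cycSrc (p q : ℕ) : CycE p q → CycV p q
  | Sum.inl i => cycVL p q i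
  | Sum.inr j => cycVR p q j

def cycTgt (p q : ℕ) : CycE p q → CycV p q
  | Sum.inl i => cycVL p q (i + 1)
  | Sum.inr j => cycVR p q (j + 1)

/-- The word `α_{s+1} α_{s+2} ⋯ α_{s+len}` of arrows on the `α`-cycle of `Δ(p,q)`. -/
def aw (p q : ℕ) (st len : ℕ) : List (CycE p q) :=
  (List.range len).map (fun u => Sum.inl ((st + u : ℕ) : ZMod p))

/-- The word `β_{s+1} β_{s+2} ⋯ β_{s+len}` of arrows on the `β`-cycle of `Δ(p,q)`. -/
def bw (p q : ℕ) (st len : ℕ) : List (CycE p q) :=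
  (List.range len).map (fun u => Sum.inr ((st + u : ℕ) : ZMod q))

section TwoCycles
variable (p q : ℕ)

/-- The relations `I₁(p,q)` of the algebra `A(p,q)`. -/
def ARelExtra : FreeAlgebra k (CycV p q ⊕ CycE p q) → FreeAlgebra k (CycV p q ⊕ CycE p q) →
    Prop := fun x y =>
  (x = arrWord k (aw p q 0 p ++ bw p q 0 q) ∧ y = arrWord k (bw p q 0 q ++ aw p q 0 p)) ∨
  (x = arrWord k (aw p q (p - 1) 1 ++ aw p q 0 1) ∧ y = 0) ∨
  (x = arrWord k (bw p q (q - 1) 1 ++ bw p q 0 1) ∧ y = 0) ∨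
  (∃ i : ℕ, 2 ≤ i ∧ i ≤ p - 1 ∧
    x = arrWord k (aw p q (i - 1) (p - i + 1) ++ bw p q 0 q ++ aw p q 0 i) ∧ y = 0) ∨
  (∃ j : ℕ, 2 ≤ j ∧ j ≤ q - 1 ∧
    x = arrWord k (bw p q (j - 1) (q - j + 1) ++ aw p q 0 p ++ bw p q 0 j) ∧ y = 0)

/-- The algebra `A(p,q) = kΔ(p,q)/I₁(p,q)`. -/
def AAlg (_ : 0 < p) (_ : 0 < q) : Type :=
  haveI : NeZero p := ⟨by omega⟩
  haveI : NeZero q := ⟨by omega⟩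
  BoundQuiverAlg k (cycSrc p q) (cycTgt p q) (ARelExtra k p q)

instance (hp : 0 < p) (hq : 0 < q) : Ring (AAlg k p q hp hq) :=
  haveI : NeZero p := ⟨by omega⟩
  haveI : NeZero q := ⟨by omega⟩
  inferInstanceAs (Ring (BoundQuiverAlg k (cycSrc p q) (cycTgt p q) (ARelExtra k p q)))

instance (hp : 0 < p) (hq : 0 < q) : Algebra k (AAlg k p q hp hq) :=
  haveI : NeZero p := ⟨by omega⟩
  haveI : NeZero q := ⟨by omega⟩
  inferInstanceAs (Algebra k (BoundQuiverAlg k (cycSrc p q) (cycTgt p q) (ARelExtra k p q)))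

/-- The relations `I₂(m)` of the algebra `Λ(m)` (on the quiver `Δ(1,m)`). -/
def LamRelExtra (m : ℕ) : FreeAlgebra k (CycV 1 m ⊕ CycE 1 m) →
    FreeAlgebra k (CycV 1 m ⊕ CycE 1 m) → Prop := fun x y =>
  (x = arrWord k (aw 1 m 0 1 ++ aw 1 m 0 1) ∧
    y = arrWord k (bw 1 m 0 m ++ bw 1 m 0 m)) ∨
  (x = arrWord k (aw 1 m 0 1 ++ bw 1 m 0 1) ∧ y = 0) ∨
  (x = arrWord k (bw 1 m (m - 1) 1 ++ aw 1 m 0 1) ∧ y = 0) ∨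
  (∃ j : ℕ, 2 ≤ j ∧ j ≤ m - 1 ∧
    x = arrWord k (bw 1 m (j - 1) (m - j + 1) ++ bw 1 m 0 m ++ bw 1 m 0 j) ∧ y = 0)

/-- The algebra `Λ(m) = kΔ(1,m)/I₂(m)`. -/
def LamAlg (m : ℕ) (_ : 0 < m) : Type :=
  haveI : NeZero m := ⟨by omega⟩
  BoundQuiverAlg k (cycSrc 1 m) (cycTgt 1 m) (LamRelExtra k m)

instance (m : ℕ) (hm : 0 < m) : Ring (LamAlg k m hm) :=
  haveI : NeZero m := ⟨by omega⟩
  inferInstanceAs (Ring (BoundQuiverAlg k (cycSrc 1 m) (cycTgt 1 m) (LamRelExtra k m)))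

instance (m : ℕ) (hm : 0 < m) : Algebra k (LamAlg k m hm) :=
  haveI : NeZero m := ⟨by omega⟩
  inferInstanceAs (Algebra k (BoundQuiverAlg k (cycSrc 1 m) (cycTgt 1 m) (LamRelExtra k m)))

/-- The relations `I₇(n)` of the algebra `Ω(n)` (on the quiver `Δ(1,n)`). -/
def OmRelExtra (n : ℕ) : FreeAlgebra k (CycV 1 n ⊕ CycE 1 n) →
    FreeAlgebra k (CycV 1 n ⊕ CycE 1 n) → Prop := fun x y =>
  (x = arrWord k (aw 1 n 0 1 ++ bw 1 n 0 n) + arrWord k (bw 1 n 0 n ++ aw 1 n 0 1) ∧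
    y = 0) ∨
  (x = arrWord k (aw 1 n 0 1 ++ aw 1 n 0 1) ∧
    y = arrWord k (aw 1 n 0 1 ++ bw 1 n 0 n)) ∨
  (x = arrWord k (bw 1 n (n - 1) 1 ++ bw 1 n 0 1) ∧ y = 0) ∨
  (∃ j : ℕ, 2 ≤ j ∧ j ≤ n - 1 ∧
    x = arrWord k (bw 1 n (j - 1) (n - j + 1) ++ aw 1 n 0 1 ++ bw 1 n 0 j) ∧ y = 0)

/-- The algebra `Ω(n) = kΔ(1,n)/I₇(n)`. -/
def OmAlg (n : ℕ) (_ : 0 < n) : Type :=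
  haveI : NeZero n := ⟨by omega⟩
  BoundQuiverAlg k (cycSrc 1 n) (cycTgt 1 n) (OmRelExtra k n)

instance (n : ℕ) (hn : 0 < n) : Ring (OmAlg k n hn) :=
  haveI : NeZero n := ⟨by omega⟩
  inferInstanceAs (Ring (BoundQuiverAlg k (cycSrc 1 n) (cycTgt 1 n) (OmRelExtra k n)))

instance (n : ℕ) (hn : 0 < n) : Algebra k (OmAlg k n hn) :=
  haveI : NeZero n := ⟨by omega⟩
  inferInstanceAs (Algebra k (BoundQuiverAlg k (cycSrc 1 n) (cycTgt 1 n) (OmRelExtra k n)))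

end TwoCycles
end QuiverAlg

section TraceModule

variable {R : Type} [Ring R]

/-- The trace of `M` in `X`: the sum of the images of all homomorphisms `M → X`. -/
def traceSubmodule (M X : Type) [AddCommGroup M] [Module R M] [AddCommGroup X] [Module R X] :
    Submodule R X :=
  ⨆ f : M →ₗ[R] X, LinearMap.range f

variable (R) in
/-- `X` is generated by `M`. For finitely generated `X` this says that `X` lies in `Fac M`. -/
def IsGenBy (M X : Type) [AddCommGroup M] [Module R M] [AddCommGroup X] [Module R X] : Prop :=
  ∀ x : X, x ∈ traceSubmodule (R := R) M X

variable (R) in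
/-- `X` is Ext-projective with respect to the modules generated by `M`. -/
def IsExtProjFor (M X : Type) [AddCommGroup M] [Module R M] [AddCommGroup X] [Module R X] : Prop :=
  ∀ (E Y : Type) [AddCommGroup E] [Module R E] [AddCommGroup Y] [Module R Y] (p : E →ₗ[R] Y),
    Function.Surjective p → IsGenBy R M (LinearMap.ker p) →
    ∀ u : X →ₗ[R] Y, ∃ v : X →ₗ[R] E, p ∘ₗ v = u

variable (R) in
/-- A brick is a nonzero module all of whose nonzero endomorphisms are bijective. -/
def IsBrick (Y : Type) [AddCommGroup Y] [Module R Y] : Prop :=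
  Nontrivial Y ∧ ∀ f : Y →ₗ[R] Y, f ≠ 0 → Function.Bijective f

variable (R) in
/-- `X` is a retract (equivalently, a direct summand) of `U`. -/
def IsRetractOf (X U : Type) [AddCommGroup X] [Module R X] [AddCommGroup U] [Module R U] : Prop :=
  ∃ (i : X →ₗ[R] U) (p : U →ₗ[R] X), p ∘ₗ i = LinearMap.id

variable {M M' X Y Z U : Type} [AddCommGroup M] [Module R M] [AddCommGroup M'] [Module R M']
  [AddCommGroup X] [Module R X] [AddCommGroup Y] [Module R Y] [AddCommGroup Z] [Module R Z]
  [AddCommGroup U] [Module R U]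

theorem apply_mem_traceSubmodule (f : M →ₗ[R] X) (x : M) : f x ∈ traceSubmodule (R := R) M X :=
  Submodule.mem_iSup_of_mem f ⟨x, rfl⟩

theorem traceSubmodule_induction {P : X → Prop} {x : X} (hx : x ∈ traceSubmodule (R := R) M X)
    (h_apply : ∀ (f : M →ₗ[R] X) (y : M), P (f y)) (h_add : ∀ x y, P x → P y → P (x + y)) :
    P x := by
  refine Submodule.iSup_induction _ (motive := P) hx ?_ ?_ h_add
  · rintro f _ ⟨y, rfl⟩
    exact h_apply f y
  · simpa using h_apply 0 0

theorem map_mem_traceSubmodule (g : X →ₗ[R] Y) {x : X} (hx : x ∈ traceSubmodule (R := R) M X) :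
    g x ∈ traceSubmodule (R := R) M Y := by
  refine traceSubmodule_induction (P := fun x => g x ∈ traceSubmodule (R := R) M Y) hx
    (fun f y => ?_) fun x y hx hy => ?_
  · exact apply_mem_traceSubmodule (g ∘ₗ f) y
  · rw [map_add]
    exact add_mem hx hy

theorem IsGenBy.of_surjective (h : IsGenBy R M X) (g : X →ₗ[R] Y) (hg : Function.Surjective g) :
    IsGenBy R M Y := by
  intro y
  obtain ⟨x, rfl⟩ := hg y
  exact map_mem_traceSubmodule g (h x)

theorem IsGenBy.self : IsGenBy R M M := fun x => apply_mem_traceSubmodule LinearMap.id x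

theorem IsGenBy.trans (h : IsGenBy R M X) (h' : IsGenBy R X Y) : IsGenBy R M Y := fun y =>
  traceSubmodule_induction (h' y) (fun f x => map_mem_traceSubmodule f (h x))
    fun _ _ => add_mem

theorem IsGenBy.prod (hX : IsGenBy R M X) (hY : IsGenBy R M Y) : IsGenBy R M (X × Y) := by
  rintro ⟨x, y⟩
  have := add_mem (map_mem_traceSubmodule (LinearMap.inl R X Y) (hX x))
    (map_mem_traceSubmodule (LinearMap.inr R X Y) (hY y))
  simpa using this

theorem IsGenBy.pi {n : ℕ} (hX : IsGenBy R M X) : IsGenBy R M (Fin n → X) := by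
  intro x
  rw [← Finset.univ_sum_single x]
  exact sum_mem fun i _ => map_mem_traceSubmodule (LinearMap.single R (fun _ => X) i) (hX (x i))

theorem isGenBy_traceSubmodule : IsGenBy R M (traceSubmodule (R := R) M X) := by
  rintro ⟨x, hx⟩
  let P : X → Prop := fun x => ∃ hx' : x ∈ traceSubmodule (R := R) M X,
    (⟨x, hx'⟩ : traceSubmodule (R := R) M X) ∈
      traceSubmodule (R := R) M (traceSubmodule (R := R) M X)
  suffices h : P x from h.2
  refine traceSubmodule_induction (P := P) hx (fun f y => ?_) ?_
  · exact ⟨apply_mem_traceSubmodule f y, apply_mem_traceSubmodule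
      (f.codRestrict (traceSubmodule (R := R) M X) (apply_mem_traceSubmodule f)) y⟩
  · rintro x y ⟨hx, hx'⟩ ⟨hy, hy'⟩
    exact ⟨add_mem hx hy, add_mem hx' hy'⟩

theorem IsGenBy.congr_left (e : M ≃ₗ[R] M') (h : IsGenBy R M X) : IsGenBy R M' X :=
  (IsGenBy.self.of_surjective e.symm.toLinearMap e.symm.surjective).trans h

theorem IsExtProjFor.congr (e : X ≃ₗ[R] Y) (h : IsExtProjFor R M X) : IsExtProjFor R M Y := by
  intro E Z _ _ _ _ p hp hker u
  obtain ⟨v, hv⟩ := h E Z p hp hker (u ∘ₗ e.toLinearMap)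
  refine ⟨v ∘ₗ e.symm.toLinearMap, ?_⟩
  rw [← LinearMap.comp_assoc, hv]
  ext y
  simp

theorem IsExtProjFor.mono (h : IsExtProjFor R M X) (hM : IsGenBy R M M') :
    IsExtProjFor R M' X := fun E Y _ _ _ _ p hp hker => h E Y p hp (hM.trans hker)

theorem IsExtProjFor.hom_quotient_eq_zero (h : IsExtProjFor R M M)
    (f : M →ₗ[R] X ⧸ traceSubmodule (R := R) M X) : f = 0 := by
  obtain ⟨v, rfl⟩ := h X _ (traceSubmodule (R := R) M X).mkQ (Submodule.mkQ_surjective _)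
    (by rw [Submodule.ker_mkQ]; exact isGenBy_traceSubmodule) f
  ext m
  exact (Submodule.Quotient.mk_eq_zero _).mpr (apply_mem_traceSubmodule v m)

theorem IsRetractOf.trans (h : IsRetractOf R X Y) (h' : IsRetractOf R Y Z) :
    IsRetractOf R X Z := by
  obtain ⟨i, p, h⟩ := h
  obtain ⟨j, q, h'⟩ := h'
  refine ⟨j ∘ₗ i, p ∘ₗ q, ?_⟩
  rw [LinearMap.comp_assoc, ← LinearMap.comp_assoc i j q, h', LinearMap.id_comp, h]

theorem IsRetractOf.of_equiv_prod (e : X ≃ₗ[R] Y × Z) : IsRetractOf R Y X :=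
  ⟨e.symm.toLinearMap ∘ₗ LinearMap.inl R Y Z, LinearMap.fst R Y Z ∘ₗ e.toLinearMap, by
    ext; simp⟩

theorem IsRetractOf.exists_equiv_prod (h : IsRetractOf R X U) :
    ∃ K : Submodule R U, Nonempty (U ≃ₗ[R] X × K) := by
  obtain ⟨i, p, h⟩ := h
  have hpi : ∀ x, p (i x) = x := fun x => LinearMap.congr_fun h x
  have hmem : ∀ u, (LinearMap.id - i ∘ₗ p : U →ₗ[R] U) u ∈ LinearMap.ker p := fun u => by
    simp [hpi]
  refine ⟨LinearMap.ker p, ⟨LinearEquiv.ofLinearMap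
    (p.prod ((LinearMap.id - i ∘ₗ p).codRestrict (LinearMap.ker p) hmem))
    (i.coprod (LinearMap.ker p).subtype) ?_ ?_⟩⟩
  · refine LinearMap.ext fun ⟨x, y, hy⟩ => ?_
    have : p y = 0 := hy
    exact Prod.ext (by simp [hpi, this]) (Subtype.ext (by simp [hpi, this]))
  · refine LinearMap.ext fun u => ?_
    simp

end TraceModule

section Bricks

variable {R : Type} [Ring R] {M M' X : Type} [AddCommGroup M] [Module R M]
  [AddCommGroup M'] [Module R M'] [AddCommGroup X] [Module R X]

/-- If `X` is generated by `M` but not by `M'`, then some brick is generated by `M` and admits no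
nonzero homomorphism from `M'`. -/
theorem exists_brick_of_not_isGenBy [IsNoetherian R X] [IsArtinian R X]
    (h' : IsExtProjFor R M' M')
    (hX : IsGenBy R M X) (hX' : ¬ IsGenBy R M' X) :
    ∃ Q : Submodule R X, IsGenBy R M (X ⧸ Q) ∧ IsBrick R (X ⧸ Q) ∧
      ∀ f : M' →ₗ[R] X ⧸ Q, f = 0 := by
  obtain ⟨Q, ⟨hQ, hQ0⟩, hmax⟩ := set_has_maximal_iff_noetherian.mpr ‹IsNoetherian R X›
    {Q : Submodule R X | Q ≠ ⊤ ∧ ∀ f : M' →ₗ[R] X ⧸ Q, f = 0}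
    ⟨traceSubmodule (R := R) M' X, fun h => hX' fun x => h ▸ Submodule.mem_top,
      fun f => h'.hom_quotient_eq_zero f⟩
  refine ⟨Q, hX.of_surjective Q.mkQ Q.mkQ_surjective,
    ⟨Submodule.Quotient.nontrivial_iff.mpr hQ, fun f hf => ?_⟩, hQ0⟩
  set K : Submodule R X := LinearMap.ker (f ∘ₗ Q.mkQ) with hK
  have hQK : Q ≤ K := fun x hx => by
    have : Q.mkQ x = 0 := by simpa using hx
    rw [hK, LinearMap.mem_ker, LinearMap.comp_apply, this, map_zero]
  have hKQ : K = Q := by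
    by_contra hne
    refine hmax K ⟨fun htop => hf ?_, fun g => ?_⟩ (lt_of_le_of_ne hQK (Ne.symm hne))
    · refine LinearMap.ext fun y => ?_
      obtain ⟨x, rfl⟩ := Q.mkQ_surjective y
      have : x ∈ K := htop ▸ Submodule.mem_top
      simpa [hK] using this
    · have hinj : Function.Injective (K.liftQ (f ∘ₗ Q.mkQ) le_rfl) := by
        rw [← LinearMap.ker_eq_bot]
        exact Submodule.ker_liftQ_eq_bot _ _ _ le_rfl
      ext m
      apply hinj
      simpa using LinearMap.congr_fun (hQ0 (K.liftQ (f ∘ₗ Q.mkQ) le_rfl ∘ₗ g)) m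
  have hinj : Function.Injective f := by
    rw [← LinearMap.ker_eq_bot, eq_bot_iff]
    intro y hy
    obtain ⟨x, rfl⟩ := Q.mkQ_surjective y
    have : x ∈ K := hy
    rw [hKQ] at this
    simpa using this
  exact ⟨hinj, IsArtinian.surjective_of_injective_endomorphism f hinj⟩

end Bricks

section KrullSchmidt

variable {R : Type} [Ring R]

variable (R) in
/-- An indecomposable module: nonzero, and without nontrivial direct sum decompositions. -/
def IsIndecomposableModule (X : Type) [AddCommGroup X] [Module R X] : Prop :=
  Nontrivial X ∧ ∀ (Y Z : Type) [AddCommGroup Y] [Module R Y] [AddCommGroup Z] [Module R Z],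
    Nonempty (X ≃ₗ[R] Y × Z) → Subsingleton Y ∨ Subsingleton Z

variable (R) in
/-- A multiplicity-free module. -/
def IsMultiplicityFree (X : Type) [AddCommGroup X] [Module R X] : Prop :=
  ∀ (L C : Type) [AddCommGroup L] [Module R L] [AddCommGroup C] [Module R C],
    Nonempty (X ≃ₗ[R] L × L × C) → Subsingleton L

variable {X Y Z U : Type} [AddCommGroup X] [Module R X] [AddCommGroup Y] [Module R Y]
  [AddCommGroup Z] [Module R Z] [AddCommGroup U] [Module R U]

theorem IsIndecomposableModule.isNilpotent_or_isUnit [IsNoetherian R X] [IsArtinian R X]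
    (hX : IsIndecomposableModule R X) (f : Module.End R X) : IsNilpotent f ∨ IsUnit f := by
  obtain ⟨n, hn, hpos⟩ :=
    (f.eventually_isCompl_ker_pow_range_pow.and (Filter.eventually_gt_atTop 0)).exists
  rcases hX.2 _ _ ⟨(Submodule.prodEquivOfIsCompl _ _ hn).symm⟩ with h | h
  · right
    have hinj : Function.Injective (f ^ n) := by
      rw [← LinearMap.ker_eq_bot]
      exact (Submodule.subsingleton_iff_eq_bot).mp h
    have : IsUnit (f ^ n) := (Module.End.isUnit_iff _).mpr
      ⟨hinj, IsArtinian.surjective_of_injective_endomorphism _ hinj⟩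
    exact (isUnit_pow_iff hpos.ne').mp this
  · left
    exact ⟨n, LinearMap.range_eq_bot.mp ((Submodule.subsingleton_iff_eq_bot).mp h)⟩

theorem IsIndecomposableModule.isRetractOf_or [IsNoetherian R X] [IsArtinian R X]
    (hX : IsIndecomposableModule R X) (h : IsRetractOf R X (Y × Z)) :
    IsRetractOf R X Y ∨ IsRetractOf R X Z := by
  obtain ⟨i, p, h⟩ := h
  set f : Module.End R X := (p ∘ₗ LinearMap.inl R Y Z) ∘ₗ (LinearMap.fst R Y Z ∘ₗ i) with hf
  set g : Module.End R X := (p ∘ₗ LinearMap.inr R Y Z) ∘ₗ (LinearMap.snd R Y Z ∘ₗ i) with hg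
  have hfg : f + g = 1 := by
    ext x
    have : p (i x) = x := LinearMap.congr_fun h x
    simp only [hf, hg, LinearMap.add_apply, LinearMap.comp_apply, ← map_add]
    simpa using this
  have key : IsUnit f ∨ IsUnit g := by
    rcases hX.isNilpotent_or_isUnit f with hf | hf
    · right
      rw [eq_sub_of_add_eq' hfg]
      exact hf.isUnit_one_sub
    · exact Or.inl hf
  rcases key with hu | hu
  · obtain ⟨u, hu⟩ := hu
    refine Or.inl ⟨LinearMap.fst R Y Z ∘ₗ i,
      (↑u⁻¹ : Module.End R X) ∘ₗ (p ∘ₗ LinearMap.inl R Y Z), ?_⟩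
    rw [LinearMap.comp_assoc, ← hf, ← hu]
    exact u.inv_mul
  · obtain ⟨u, hu⟩ := hu
    refine Or.inr ⟨LinearMap.snd R Y Z ∘ₗ i,
      (↑u⁻¹ : Module.End R X) ∘ₗ (p ∘ₗ LinearMap.inr R Y Z), ?_⟩
    rw [LinearMap.comp_assoc, ← hg, ← hu]
    exact u.inv_mul

theorem IsRetractOf.nontrivial [Nontrivial X] (h : IsRetractOf R X U) : Nontrivial U := by
  obtain ⟨i, p, h⟩ := h
  exact (Function.LeftInverse.injective (g := p) (LinearMap.congr_fun h)).nontrivial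

theorem IsRetractOf.of_equiv (e : X ≃ₗ[R] Y) : IsRetractOf R X Y :=
  ⟨e.toLinearMap, e.symm.toLinearMap, by ext; simp⟩

theorem IsIndecomposableModule.isRetractOf_of_pi [IsNoetherian R X] [IsArtinian R X]
    (hX : IsIndecomposableModule R X) :
    ∀ {n : ℕ}, IsRetractOf R X (Fin n → U) → IsRetractOf R X U
  | 0, h => by
    have := hX.1
    have := h.nontrivial
    exact absurd this (not_nontrivial _)
  | n + 1, h => by
    rcases hX.isRetractOf_or
      (h.trans (.of_equiv (Fin.consLinearEquiv R (fun _ : Fin (n + 1) => U)).symm)) with h | h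
    · exact h
    · exact hX.isRetractOf_of_pi h

theorem IsIndecomposableModule.congr (e : X ≃ₗ[R] Y) (hX : IsIndecomposableModule R X) :
    IsIndecomposableModule R Y := by
  have := hX.1
  exact ⟨e.symm.surjective.nontrivial, fun V W _ _ _ _ ⟨f⟩ => hX.2 V W ⟨e.trans f⟩⟩

theorem IsIndecomposableModule.equiv_of_isRetractOf (hX : Nontrivial X)
    (hU : IsIndecomposableModule R U) (h : IsRetractOf R X U) : Nonempty (X ≃ₗ[R] U) := by
  obtain ⟨K, ⟨e⟩⟩ := h.exists_equiv_prod
  rcases hU.2 _ _ ⟨e⟩ with h | h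
  · exact absurd hX (not_nontrivial_iff_subsingleton.mpr h)
  · have : Unique K := ⟨⟨0⟩, fun x => Subsingleton.elim _ _⟩
    exact ⟨(e.trans LinearEquiv.prodUnique).symm⟩

theorem exists_nontrivial_decomposition [Nontrivial X] (hX : ¬ IsIndecomposableModule R X) :
    ∃ (Y Z : Type) (_ : AddCommGroup Y) (_ : Module R Y) (_ : AddCommGroup Z) (_ : Module R Z),
      Nonempty (X ≃ₗ[R] Y × Z) ∧ Nontrivial Y ∧ Nontrivial Z := by
  by_contra! hcon
  refine hX ⟨inferInstance, fun Y Z _ _ _ _ h => ?_⟩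
  by_contra! h'
  exact not_nontrivial_iff_subsingleton.mpr (hcon Y Z _ _ _ _ h h'.1) h'.2

theorem isNoetherian_and_isArtinian_of_equiv_prod [IsNoetherian R X] [IsArtinian R X]
    (e : X ≃ₗ[R] Y × Z) : (IsNoetherian R Y ∧ IsArtinian R Y) ∧ IsNoetherian R Z ∧ IsArtinian R Z :=
  have hY : Function.Surjective (LinearMap.fst R Y Z ∘ₗ e.toLinearMap) :=
    Prod.fst_surjective.comp e.surjective
  have hZ : Function.Surjective (LinearMap.snd R Y Z ∘ₗ e.toLinearMap) :=
    Prod.snd_surjective.comp e.surjective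
  ⟨⟨isNoetherian_of_surjective _ (LinearMap.range_eq_top.mpr hY), isArtinian_of_surjective _ _ hY⟩,
    isNoetherian_of_surjective _ (LinearMap.range_eq_top.mpr hZ), isArtinian_of_surjective _ _ hZ⟩

theorem length_lt_of_equiv_prod [IsNoetherian R X] [IsArtinian R X] [Nontrivial Y] [Nontrivial Z]
    (e : X ≃ₗ[R] Y × Z) :
    Module.length R Y < Module.length R X ∧ Module.length R Z < Module.length R X := by
  have hlen := e.length_eq.trans (Module.length_prod R Y Z)
  have hX := Module.length_ne_top (R := R) (M := X)
  have hY : 0 < Module.length R Y := Module.length_pos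
  have hZ : 0 < Module.length R Z := Module.length_pos
  rw [hlen] at hX ⊢
  obtain ⟨hY', hZ'⟩ := WithTop.add_ne_top.mp hX
  exact ⟨add_comm (Module.length R Z) _ ▸ ENat.lt_add_left hY' hZ, ENat.lt_add_left hZ' hY⟩

theorem exists_indecomposable_summand (n : ℕ∞) :
    ∀ (X : Type) [AddCommGroup X] [Module R X] [IsNoetherian R X] [IsArtinian R X] [Nontrivial X],
      Module.length R X = n → ∃ (Y : Type) (_ : AddCommGroup Y) (_ : Module R Y),
        IsIndecomposableModule R Y ∧ IsRetractOf R Y X := by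
  induction n using WellFoundedLT.induction with
  | ind n ih =>
    intro X _ _ _ _ _ hn
    by_cases hX : IsIndecomposableModule R X
    · exact ⟨X, _, _, hX, .of_equiv (.refl R X)⟩
    · obtain ⟨Y, Z, _, _, _, _, ⟨e⟩, _, _⟩ := exists_nontrivial_decomposition hX
      have hlt := (length_lt_of_equiv_prod e).1
      obtain ⟨⟨_, _⟩, -⟩ := isNoetherian_and_isArtinian_of_equiv_prod e
      obtain ⟨V, _, _, hV, hVY⟩ := ih _ (hn ▸ hlt) Y rfl
      exact ⟨V, _, _, hV, hVY.trans (.of_equiv_prod e)⟩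

theorem exists_finite_indecomposable_retracts (n : ℕ∞) :
    ∀ (U : Type) [AddCommGroup U] [Module R U] [IsNoetherian R U] [IsArtinian R U],
      Module.length R U = n → ∃ (ι : Type) (_ : Finite ι) (V : ι → ModuleCat.{0} R),
        ∀ (X : Type) [AddCommGroup X] [Module R X] [IsNoetherian R X] [IsArtinian R X],
          IsIndecomposableModule R X → IsRetractOf R X U → ∃ j, Nonempty (X ≃ₗ[R] V j) := by
  induction n using WellFoundedLT.induction with
  | ind n ih =>
    intro U _ _ _ _ hn
    by_cases hU : IsIndecomposableModule R U
    · exact ⟨Unit, inferInstance, fun _ => ModuleCat.of R U, fun X _ _ _ _ hX h =>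
        ⟨(), hU.equiv_of_isRetractOf hX.1 h⟩⟩
    · by_cases hnt : Nontrivial U
      · obtain ⟨Y, Z, _, _, _, _, ⟨e⟩, _, _⟩ := exists_nontrivial_decomposition hU
        obtain ⟨hltY, hltZ⟩ := length_lt_of_equiv_prod e
        obtain ⟨⟨_, _⟩, _, _⟩ := isNoetherian_and_isArtinian_of_equiv_prod e
        obtain ⟨ι, _, V, hV⟩ := ih _ (hn ▸ hltY) Y rfl
        obtain ⟨κ, _, W, hW⟩ := ih _ (hn ▸ hltZ) Z rfl
        refine ⟨ι ⊕ κ, inferInstance, Sum.elim V W, fun X _ _ _ _ hX h => ?_⟩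
        rcases hX.isRetractOf_or (h.trans (.of_equiv e)) with h | h
        · obtain ⟨j, hj⟩ := hV X hX h
          exact ⟨Sum.inl j, hj⟩
        · obtain ⟨j, hj⟩ := hW X hX h
          exact ⟨Sum.inr j, hj⟩
      · refine ⟨Empty, inferInstance, Empty.elim, fun X _ _ _ _ hX h => ?_⟩
        have := hX.1
        exact absurd h.nontrivial hnt

theorem IsMultiplicityFree.of_equiv_prod (h : IsMultiplicityFree R X) (e : X ≃ₗ[R] Y × Z) :
    IsMultiplicityFree R Z := by
  rintro L C _ _ _ _ ⟨f⟩
  refine h L (C × Y) ⟨e.trans ((LinearEquiv.prodComm R Y Z).trans ((f.prodCongr (.refl R Y)).trans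
    ((LinearEquiv.prodAssoc R L (L × C) Y).trans
      ((LinearEquiv.refl R L).prodCongr (LinearEquiv.prodAssoc R L C Y)))))⟩

/-- Up to isomorphism, only finitely many multiplicity-free modules are direct summands of finite
powers of a given module of finite length. -/
theorem exists_finite_multiplicityFree_retracts (U : Type) [AddCommGroup U] [Module R U]
    [IsNoetherian R U] [IsArtinian R U] :
    ∃ (κ : Type) (_ : Finite κ) (W : κ → ModuleCat.{0} R),
      ∀ (X : Type) [AddCommGroup X] [Module R X] [IsNoetherian R X] [IsArtinian R X],
        IsMultiplicityFree R X → (∃ s : ℕ, IsRetractOf R X (Fin s → U)) →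
          ∃ i, Nonempty (X ≃ₗ[R] W i) := by
  classical
  obtain ⟨ι, _, V, hV⟩ := exists_finite_indecomposable_retracts _ U (rfl : Module.length R U = _)
  have := Fintype.ofFinite ι
  suffices h : ∀ S : Finset ι, ∃ (κ : Type) (_ : Finite κ) (W : κ → ModuleCat.{0} R),
      ∀ (X : Type) [AddCommGroup X] [Module R X] [IsNoetherian R X] [IsArtinian R X],
        IsMultiplicityFree R X → (∃ s : ℕ, IsRetractOf R X (Fin s → U)) →
          (∀ j, IsIndecomposableModule R (V j) → IsRetractOf R (V j) X → j ∈ S) →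
          ∃ i, Nonempty (X ≃ₗ[R] W i) by
    obtain ⟨κ, hκ, W, hW⟩ := h Finset.univ
    exact ⟨κ, hκ, W, fun X _ _ _ _ hX hs => hW X hX hs fun _ _ _ => Finset.mem_univ _⟩
  intro S
  induction S using Finset.strongInduction with
  | H S ih =>
    choose κ hκ W hW using fun j : S => ih (S.erase j) (Finset.erase_ssubset j.2)
    refine ⟨Option (Σ j : S, κ j), inferInstance, fun o => o.elim (ModuleCat.of R PUnit)
      fun j => ModuleCat.of R (V j.1 × W j.1 j.2), fun X _ _ _ _ hX hs hS => ?_⟩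
    by_cases hnt : Nontrivial X
    · obtain ⟨Y, _, _, hY, hYX⟩ := exists_indecomposable_summand (R := R) _ X rfl
      obtain ⟨s, hs⟩ := hs
      obtain ⟨K, ⟨e⟩⟩ := hYX.exists_equiv_prod
      obtain ⟨⟨_, _⟩, _, _⟩ := isNoetherian_and_isArtinian_of_equiv_prod e
      obtain ⟨j, ⟨f⟩⟩ := hV Y hY (hY.isRetractOf_of_pi (hYX.trans hs))
      have hVj := hY.congr f
      have hj : j ∈ S := hS j hVj ((IsRetractOf.of_equiv f.symm).trans hYX)
      have hKX : IsRetractOf R K X := .of_equiv_prod (e.trans (LinearEquiv.prodComm R Y K))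
      obtain ⟨i, ⟨g⟩⟩ := hW ⟨j, hj⟩ K (hX.of_equiv_prod e) ⟨s, hKX.trans hs⟩ fun j' hj' hjK => by
        refine Finset.mem_erase.mpr ⟨?_, hS j' hj' (hjK.trans hKX)⟩
        rintro rfl
        obtain ⟨C, ⟨c⟩⟩ := hjK.exists_equiv_prod
        have := hX (V j') C ⟨e.trans (f.prodCongr c)⟩
        exact not_nontrivial_iff_subsingleton.mpr this hVj.1
      exact ⟨some ⟨⟨j, hj⟩, i⟩, ⟨e.trans (f.prodCongr g)⟩⟩
    · have := not_nontrivial_iff_subsingleton.mp hnt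
      exact ⟨none, ⟨(0 : X ≃ₗ[R] PUnit)⟩⟩

end KrullSchmidt

section Approximations

variable (k : Type) [Field k] {R : Type} [Ring R] [Algebra k R]

theorem isNoetherian_and_isArtinian_of_finite_over_field (X : Type) [AddCommGroup X] [Module k X]
    [Module R X] [IsScalarTower k R X] [Module.Finite k X] : IsNoetherian R X ∧ IsArtinian R X :=
  ⟨isNoetherian_of_tower k inferInstance, isArtinian_of_tower k inferInstance⟩

/-- Every pair of finite-dimensional modules `U`, `X` admits a right `add U`-approximation
of `X`. -/
theorem exists_right_approximation (U X : Type) [AddCommGroup U] [Module k U] [Module R U]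
    [IsScalarTower k R U] [Module.Finite k U] [AddCommGroup X] [Module k X] [Module R X]
    [IsScalarTower k R X] [Module.Finite k X] :
    ∃ (s : ℕ) (π : (Fin s → U) →ₗ[R] X), ∀ g : U →ₗ[R] X, ∃ t : U →ₗ[R] Fin s → U,
      π ∘ₗ t = g := by
  have : SMulCommClass R k X := IsScalarTower.to_smulCommClass'
  have : SMulCommClass R k U := IsScalarTower.to_smulCommClass'
  have : Module.Finite k (U →ₗ[R] X) :=
    Module.Finite.of_injective (LinearMap.restrictScalarsₗ k R U X k)
      (LinearMap.restrictScalars_injective k)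
  obtain ⟨s, F, hF⟩ := Module.Finite.exists_fin (R := k) (M := U →ₗ[R] X)
  refine ⟨s, ∑ i, F i ∘ₗ LinearMap.proj i, fun g => ?_⟩
  obtain ⟨a, rfl⟩ := (Submodule.mem_span_range_iff_exists_fun k).mp
    (hF ▸ Submodule.mem_top : g ∈ Submodule.span k (Set.range F))
  refine ⟨LinearMap.pi fun i => a i • LinearMap.id, ?_⟩
  ext u
  have (i : Fin s) : F i (a i • u) = a i • F i u := (F i).map_smul_of_tower (a i) u
  simp [this]

/-- For a finite-dimensional module `M` with generators `b j`, the homomorphism `R → M ^ r`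
sending `1` to `b` is a left approximation by the modules generated by `M`. -/
theorem IsGenBy.exists_apply_eq {M X : Type} [AddCommGroup M] [Module k M] [Module R M]
    [IsScalarTower k R M] [AddCommGroup X] [Module R X] {r : ℕ} {b : Fin r → M}
    (hb : Submodule.span k (Set.range b) = ⊤) (hX : IsGenBy R M X) (x : X) :
    ∃ w : (Fin r → M) →ₗ[R] X, w b = x := by
  have : SMulCommClass R k M := IsScalarTower.to_smulCommClass'
  refine traceSubmodule_induction (P := fun x => ∃ w : (Fin r → M) →ₗ[R] X, w b = x) (hX x) ?_ ?_
  · intro f y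
    obtain ⟨a, rfl⟩ := (Submodule.mem_span_range_iff_exists_fun k).mp
      (hb ▸ Submodule.mem_top : y ∈ Submodule.span k (Set.range b))
    exact ⟨f ∘ₗ ∑ i, a i • LinearMap.proj i, by simp⟩
  · rintro _ _ ⟨w, rfl⟩ ⟨w', rfl⟩
    exact ⟨w + w', rfl⟩

theorem isGenBy_of_forall_exists_apply_eq {M X : Type} [AddCommGroup M] [Module R M]
    [AddCommGroup X] [Module R X] {r : ℕ} {b : Fin r → M}
    (h : ∀ x : X, ∃ w : (Fin r → M) →ₗ[R] X, w b = x) : IsGenBy R M X := by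
  intro x
  obtain ⟨w, rfl⟩ := h x
  exact map_mem_traceSubmodule w (IsGenBy.self.pi b)

/-- The modules which are generated by `M` and Ext-projective among the modules generated by `M`
are all direct summands of powers of a single module. -/
theorem exists_isRetractOf_pi (M : Type) [AddCommGroup M] [Module k M] [Module R M]
    [IsScalarTower k R M] [Module.Finite k M] :
    ∃ (U : Type) (_ : AddCommGroup U) (_ : Module R U), (IsNoetherian R U ∧ IsArtinian R U) ∧
      ∀ (X : Type) [AddCommGroup X] [Module k X] [Module R X] [IsScalarTower k R X]
        [Module.Finite k X], IsGenBy R M X → IsExtProjFor R M X →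
        ∃ s : ℕ, IsRetractOf R X (Fin s → U) := by
  obtain ⟨r, b, hb⟩ := Module.Finite.exists_fin (R := k) (M := M)
  let D : Submodule R (Fin r → M) := Submodule.span R {b}
  refine ⟨M × ((Fin r → M) ⧸ D), inferInstance, inferInstance,
    isNoetherian_and_isArtinian_of_finite_over_field k _, fun X _ _ _ _ _ hX hext => ?_⟩
  have hU : IsGenBy R M (M × ((Fin r → M) ⧸ D)) :=
    IsGenBy.self.prod (IsGenBy.self.pi.of_surjective D.mkQ D.mkQ_surjective)
  obtain ⟨s, π, hπ⟩ := exists_right_approximation k (R := R) (M × ((Fin r → M) ⧸ D)) X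
  have hsurj : Function.Surjective π := by
    rw [← LinearMap.range_eq_top, eq_top_iff]
    rintro x -
    refine traceSubmodule_induction (hX x) (fun f y => ?_) fun _ _ => add_mem
    obtain ⟨t, ht⟩ := hπ (f ∘ₗ LinearMap.fst R M _)
    exact ⟨t (y, 0), LinearMap.congr_fun ht (y, 0)⟩
  have hker : IsGenBy R M (LinearMap.ker π) := by
    refine isGenBy_of_forall_exists_apply_eq (b := b) fun ⟨l, hl⟩ => ?_
    obtain ⟨w, hw⟩ := hU.pi.exists_apply_eq k hb l
    have hDle : D ≤ LinearMap.ker (π ∘ₗ w) :=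
      (Submodule.span_singleton_le_iff_mem b _).mpr (by
        rw [LinearMap.mem_ker, LinearMap.comp_apply, hw]
        exact hl)
    obtain ⟨t, ht⟩ := hπ (D.liftQ (π ∘ₗ w) hDle ∘ₗ LinearMap.snd R M _)
    refine ⟨(w - t ∘ₗ LinearMap.inr R M _ ∘ₗ D.mkQ).codRestrict (LinearMap.ker π) fun z => ?_, ?_⟩
    · have := LinearMap.congr_fun ht (0, D.mkQ z)
      simp only [LinearMap.comp_apply, LinearMap.snd_apply, Submodule.mkQ_apply,
        Submodule.liftQ_apply] at this
      simp [this]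
    · have hbD : D.mkQ b = 0 :=
        (Submodule.Quotient.mk_eq_zero _).mpr (Submodule.mem_span_singleton_self b)
      apply Subtype.ext
      change w b - t (LinearMap.inr R M _ (D.mkQ b)) = l
      rw [hbD, map_zero, map_zero, sub_zero, hw]
  obtain ⟨v, hv⟩ := hext _ X π hsurj hker LinearMap.id
  exact ⟨s, v, π, hv⟩

end Approximations

section BrickFinite

/-- If there are only finitely many finitely generated bricks up to isomorphism, then there are
only finitely many multiplicity-free finitely generated modules `M` that are Ext-projective
among the modules generated by `M`. -/
theorem exists_finite_isExtProjFor_self (k R : Type) [Field k] [Ring R] [Algebra k R]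
    [Module.Finite k R] {n : ℕ} (S : Fin n → ModuleCat.{0} R)
    (hS : ∀ (Y : Type) [AddCommGroup Y] [Module R Y] [Module.Finite R Y], IsBrick R Y →
      ∃ i, Nonempty (Y ≃ₗ[R] S i)) :
    ∃ (κ : Type) (_ : Finite κ) (W : κ → ModuleCat.{0} R),
      ∀ (M : Type) [AddCommGroup M] [Module R M] [Module.Finite R M], IsExtProjFor R M M →
        IsMultiplicityFree R M → ∃ i, Nonempty (M ≃ₗ[R] W i) := by
  have hfin (X : Type) [AddCommGroup X] [Module R X] [Module.Finite R X] :
      IsNoetherian R X ∧ IsArtinian R X := by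
    let _ : Module k X := Module.compHom X (algebraMap k R)
    have : IsScalarTower k R X := IsScalarTower.of_compHom k R X
    have : Module.Finite k X := Module.Finite.trans R X
    exact isNoetherian_and_isArtinian_of_finite_over_field k X
  have hgen (M M' : Type) [AddCommGroup M] [Module R M] [Module.Finite R M] [AddCommGroup M']
      [Module R M'] (hM' : IsExtProjFor R M' M')
      (h : ∀ i, IsGenBy R M (S i) → IsGenBy R M' (S i)) : IsGenBy R M' M := by
    by_contra hcon
    obtain ⟨_, _⟩ := hfin M
    obtain ⟨Q, hQ, hbrick, hzero⟩ := exists_brick_of_not_isGenBy hM' IsGenBy.self hcon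
    obtain ⟨i, ⟨e⟩⟩ := hS _ hbrick
    have hQ' : IsGenBy R M' (M ⧸ Q) :=
      (h i (hQ.of_surjective e.toLinearMap e.surjective)).of_surjective e.symm.toLinearMap
        e.symm.surjective
    have := hbrick.1
    obtain ⟨y, hy⟩ := exists_ne (0 : M ⧸ Q)
    refine hy (traceSubmodule_induction (P := fun y => y = 0) (hQ' y) (fun f x => ?_)
      fun x y hx hy => ?_)
    · rw [hzero f, LinearMap.zero_apply]
    · rw [hx, hy, add_zero]
  have key (T : Set (Fin n)) : ∃ (κ : Type) (_ : Finite κ) (W : κ → ModuleCat.{0} R),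
      ∀ (M : Type) [AddCommGroup M] [Module R M] [Module.Finite R M], IsExtProjFor R M M →
        IsMultiplicityFree R M → {i | IsGenBy R M (S i)} = T → ∃ i, Nonempty (M ≃ₗ[R] W i) := by
    by_cases h : ∃ (M : Type) (_ : AddCommGroup M) (_ : Module R M), Module.Finite R M ∧
        IsExtProjFor R M M ∧ {i | IsGenBy R M (S i)} = T
    · obtain ⟨M, _, _, _, hM, hMT⟩ := h
      let _ : Module k M := Module.compHom M (algebraMap k R)
      have : IsScalarTower k R M := IsScalarTower.of_compHom k R M
      have : Module.Finite k M := Module.Finite.trans R M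
      obtain ⟨U, _, _, ⟨_, _⟩, hU⟩ := exists_isRetractOf_pi k (R := R) M
      obtain ⟨κ, hκ, W, hW⟩ := exists_finite_multiplicityFree_retracts (R := R) U
      refine ⟨κ, hκ, W, fun X _ _ _ hX hfree hXT => ?_⟩
      obtain ⟨_, _⟩ := hfin X
      let _ : Module k X := Module.compHom X (algebraMap k R)
      have : IsScalarTower k R X := IsScalarTower.of_compHom k R X
      have : Module.Finite k X := Module.Finite.trans R X
      have hMX : IsGenBy R M X := hgen X M hM fun i hi => by
        have : i ∈ {i | IsGenBy R M (S i)} := by rw [hMT, ← hXT]; exact hi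
        exact this
      have hXM : IsGenBy R X M := hgen M X hX fun i hi => by
        have : i ∈ {i | IsGenBy R X (S i)} := by rw [hXT, ← hMT]; exact hi
        exact this
      exact hW X hfree (hU X hMX (hX.mono hXM))
    · exact ⟨Empty, inferInstance, Empty.elim, fun M _ _ hM hM' _ hT =>
        absurd ⟨M, _, _, hM, hM', hT⟩ h⟩
  choose κ hκ W hW using key
  refine ⟨Σ T, κ T, inferInstance, fun p => W p.1 p.2, fun M _ _ _ hM hfree => ?_⟩
  obtain ⟨i, hi⟩ := hW _ M hM hfree rfl
  exact ⟨⟨_, i⟩, hi⟩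

end BrickFinite

section ProjectiveCovers

variable {R : Type} [Ring R]

theorem exists_projectiveCover [IsNoetherian R R] [IsArtinian R R] (M : Type) [AddCommGroup M]
    [Module R M] [Module.Finite R M] :
    ∃ (Q : Type) (_ : AddCommGroup Q) (_ : Module R Q) (g : Q →ₗ[R] M), Module.Projective R Q ∧
      Module.Finite R Q ∧ Function.Surjective g ∧ SuperfluousSubmodule (LinearMap.ker g) := by
  obtain ⟨n, g, hg⟩ := Module.Finite.exists_fin' R M
  obtain ⟨_, ⟨φ, hφ, rfl⟩, hmin⟩ := IsArtinian.set_has_minimal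
    {Q : Submodule R (Fin n → R) | ∃ φ : (Fin n → R) →ₗ[R] (Fin n → R),
      g ∘ₗ φ = g ∧ LinearMap.range φ = Q}
    ⟨_, LinearMap.id, LinearMap.comp_id g, rfl⟩
  have hmin' (ψ : (Fin n → R) →ₗ[R] (Fin n → R)) (hψ : g ∘ₗ ψ = g)
      (hle : LinearMap.range ψ ≤ LinearMap.range φ) : LinearMap.range ψ = LinearMap.range φ := by
    by_contra hne
    exact hmin _ ⟨ψ, hψ, rfl⟩ (lt_of_le_of_ne hle hne)
  set Q := LinearMap.range φ with hQ
  have hgφ (x) : g (φ x) = g x := LinearMap.congr_fun hφ x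
  have hφφ := hmin' (φ ∘ₗ φ) (by rw [← LinearMap.comp_assoc, hφ, hφ])
    (LinearMap.range_comp_le_range _ _)
  let σ : Q →ₗ[R] Q := φ.rangeRestrict ∘ₗ Q.subtype
  have hσ : Function.Surjective σ := by
    rintro ⟨y, hy⟩
    rw [← hφφ] at hy
    obtain ⟨x, rfl⟩ := hy
    exact ⟨⟨φ x, x, rfl⟩, rfl⟩
  let e : Q ≃ₗ[R] Q :=
    LinearEquiv.ofBijective σ ⟨IsNoetherian.injective_of_surjective_endomorphism σ hσ, hσ⟩
  have hproj : Module.Projective R Q :=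
    Module.Projective.of_split Q.subtype (e.symm.toLinearMap ∘ₗ φ.rangeRestrict)
      (LinearMap.ext fun x => e.symm_apply_apply x)
  have hsurj : Function.Surjective (g ∘ₗ Q.subtype) := fun m => by
    obtain ⟨x, rfl⟩ := hg m
    exact ⟨⟨φ x, x, rfl⟩, hgφ x⟩
  refine ⟨Q, inferInstance, inferInstance, g ∘ₗ Q.subtype, hproj, inferInstance, hsurj,
    fun K hK => ?_⟩
  have hKsurj : Function.Surjective ((g ∘ₗ Q.subtype) ∘ₗ K.subtype) := fun m => by
    obtain ⟨x, rfl⟩ := hsurj m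
    obtain ⟨y, hy, z, hz, rfl⟩ := Submodule.mem_sup.mp (hK ▸ Submodule.mem_top : x ∈ _ ⊔ K)
    exact ⟨⟨z, hz⟩, by rw [map_add, LinearMap.mem_ker.mp hy, zero_add]; rfl⟩
  obtain ⟨h, hh⟩ := Module.projective_lifting_property _ (g ∘ₗ Q.subtype) hKsurj
  have hrange := hmin' (Q.subtype ∘ₗ K.subtype ∘ₗ h ∘ₗ φ.rangeRestrict)
    (LinearMap.ext fun x => (LinearMap.congr_fun hh (φ.rangeRestrict x)).trans (hgφ x))
    (LinearMap.range_comp_le_range _ _ |>.trans_eq Q.range_subtype)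
  rw [eq_top_iff]
  rintro ⟨y, hy⟩ -
  have hy' := hy
  rw [← hrange] at hy'
  obtain ⟨x, rfl⟩ := hy'
  exact (h (φ.rangeRestrict x)).2

theorem exists_dualBasis (P : Type) [AddCommGroup P] [Module R P] [Module.Finite R P]
    [Module.Projective R P] :
    ∃ (n : ℕ) (b : Fin n → P) (c : Fin n → P →ₗ[R] R), ∀ p, ∑ i, c i p • b i = p := by
  obtain ⟨n, π, hπ⟩ := Module.Finite.exists_fin' R P
  obtain ⟨s, hs⟩ := Module.projective_lifting_property π LinearMap.id hπ
  refine ⟨n, fun i => π (Pi.single i 1), fun i => LinearMap.proj i ∘ₗ s, fun p => ?_⟩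
  conv_rhs => rw [← LinearMap.id_apply (R := R) p, ← hs, LinearMap.comp_apply,
    ← Finset.univ_sum_single (s p), map_sum]
  refine Finset.sum_congr rfl fun i _ => ?_
  rw [← map_smul]
  congr 1
  ext j
  simp [Pi.single_apply]

/-- If `P` is finitely generated projective and every homomorphism `P → M` factors through
`f : P → P₀` with `P₀` projective, then so does every homomorphism from `P` to a module generated
by `M`. -/
theorem IsGenBy.exists_comp_eq {P P₀ M X : Type} [AddCommGroup P] [Module R P] [Module.Finite R P]
    [Module.Projective R P] [AddCommGroup P₀] [Module R P₀] [AddCommGroup M] [Module R M]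
    [AddCommGroup X] [Module R X] {f : P →ₗ[R] P₀}
    (hf : ∀ w : P →ₗ[R] M, ∃ v : P₀ →ₗ[R] M, v ∘ₗ f = w) (hX : IsGenBy R M X) (w : P →ₗ[R] X) :
    ∃ v : P₀ →ₗ[R] X, v ∘ₗ f = w := by
  obtain ⟨n, b, c, hbc⟩ := exists_dualBasis (R := R) P
  have h (i : Fin n) (x : X) : ∃ v : P₀ →ₗ[R] X, v ∘ₗ f = (c i).smulRight x := by
    refine traceSubmodule_induction
      (P := fun x => ∃ v : P₀ →ₗ[R] X, v ∘ₗ f = (c i).smulRight x) (hX x) ?_ ?_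
    · intro g y
      obtain ⟨v, hv⟩ := hf ((c i).smulRight y)
      refine ⟨g ∘ₗ v, ?_⟩
      rw [LinearMap.comp_assoc, hv]
      ext
      simp
    · rintro x y ⟨v, hv⟩ ⟨v', hv'⟩
      refine ⟨v + v', ?_⟩
      rw [LinearMap.add_comp, hv, hv']
      ext
      simp
  choose v hv using h
  refine ⟨∑ i, v i (w (b i)), LinearMap.ext fun p => ?_⟩
  conv_rhs => rw [← hbc p, map_sum]
  rw [LinearMap.comp_apply, LinearMap.sum_apply]
  refine Finset.sum_congr rfl fun i _ => ?_
  rw [map_smul]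
  exact LinearMap.congr_fun (hv i (w (b i))) p

/-- Let `P₁ → P₀ → M → 0` be a projective presentation such that every homomorphism `P₁ → M`
factors through `P₀`. Then `M` is Ext-projective among the modules generated by `M`. -/
theorem isExtProjFor_self_of_presentation {P₁ P₀ M : Type} [AddCommGroup P₁] [Module R P₁]
    [Module.Finite R P₁] [Module.Projective R P₁] [AddCommGroup P₀] [Module R P₀]
    [Module.Projective R P₀] [AddCommGroup M] [Module R M] {f : P₁ →ₗ[R] P₀} {g : P₀ →ₗ[R] M}
    (hg : Function.Surjective g) (hfg : LinearMap.range f = LinearMap.ker g)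
    (hf : ∀ w : P₁ →ₗ[R] M, ∃ v : P₀ →ₗ[R] M, v ∘ₗ f = w) : IsExtProjFor R M M := by
  intro E Y _ _ _ _ p hp hker u
  obtain ⟨v, hv⟩ := Module.projective_lifting_property p (u ∘ₗ g) hp
  have hgf (x) : g (f x) = 0 := LinearMap.mem_ker.mp (hfg ▸ ⟨x, rfl⟩)
  have hmem (x) : (v ∘ₗ f) x ∈ LinearMap.ker p := by
    have := LinearMap.congr_fun hv (f x)
    simp only [LinearMap.comp_apply] at this
    rw [LinearMap.mem_ker, LinearMap.comp_apply, this, hgf, map_zero]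
  obtain ⟨w, hw⟩ := hker.exists_comp_eq hf ((v ∘ₗ f).codRestrict _ hmem)
  have hle : LinearMap.ker g ≤ LinearMap.ker (v - (LinearMap.ker p).subtype ∘ₗ w) := by
    rw [← hfg]
    rintro _ ⟨x, rfl⟩
    have := congrArg Subtype.val (LinearMap.congr_fun hw x)
    simp only [LinearMap.comp_apply] at this
    rw [LinearMap.mem_ker, LinearMap.sub_apply, LinearMap.comp_apply, Submodule.subtype_apply,
      this]
    exact sub_self _
  let e := g.quotKerEquivOfSurjective hg
  refine ⟨(LinearMap.ker g).liftQ _ hle ∘ₗ e.symm.toLinearMap, LinearMap.ext fun m => ?_⟩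
  obtain ⟨x, rfl⟩ := hg m
  have hx : e.symm (g x) = (LinearMap.ker g).mkQ x := by
    rw [LinearEquiv.symm_apply_eq]
    rfl
  have := LinearMap.congr_fun hv x
  simp only [LinearMap.comp_apply] at this
  simp [hx, this]

end ProjectiveCovers

section TauRigid

variable (k : Type) [Field k] {B : Type} [Ring B] [Algebra k B]

/-- The homomorphism `p ↦ m · h p` of right modules. -/
def rankOneHom {P M : Type} [AddCommGroup P] [Module Bᵐᵒᵖ P] [AddCommGroup M] [Module Bᵐᵒᵖ M]
    (h : P →ₗ[Bᵐᵒᵖ] B) (m : M) : P →ₗ[Bᵐᵒᵖ] M where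
  toFun p := op (h p) • m
  map_add' x y := by rw [map_add, MulOpposite.op_add, add_smul]
  map_smul' r p := by
    rw [map_smul, RingHom.id_apply, MulOpposite.smul_eq_mul_unop, op_mul, op_unop, mul_smul]

/-- If `M` is `τ`-rigid then every homomorphism `P₁ → M` factors through `P₀`, for the minimal
projective presentation `P₁ → P₀ → M → 0`. -/
theorem IsTauRigid.exists_comp_eq {M P₁ P₀ : ModuleCat.{0} Bᵐᵒᵖ} (hM : IsTauRigid k B M)
    [Module.Finite Bᵐᵒᵖ P₁] {f : P₁ →ₗ[Bᵐᵒᵖ] P₀} {g : P₀ →ₗ[Bᵐᵒᵖ] M}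
    (hfg : IsMinimalProjPresentation B M P₁ P₀ f g) (w : P₁ →ₗ[Bᵐᵒᵖ] M) :
    ∃ v : P₀ →ₗ[Bᵐᵒᵖ] M, v ∘ₗ f = w := by
  let _ : Module k M := Module.compHom M (algebraMap k Bᵐᵒᵖ)
  have : IsScalarTower k Bᵐᵒᵖ M := IsScalarTower.of_compHom k Bᵐᵒᵖ M
  have : SMulCommClass Bᵐᵒᵖ k M := IsScalarTower.to_smulCommClass'
  let W : Submodule k (P₁ →ₗ[Bᵐᵒᵖ] M) :=
    { carrier := {w | ∃ v : P₀ →ₗ[Bᵐᵒᵖ] M, v ∘ₗ f = w}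
      zero_mem' := ⟨0, LinearMap.zero_comp f⟩
      add_mem' := by
        rintro _ _ ⟨v, rfl⟩ ⟨v', rfl⟩
        exact ⟨v + v', LinearMap.add_comp f v' v⟩
      smul_mem' := by
        rintro c _ ⟨v, rfl⟩
        exact ⟨c • v, LinearMap.smul_comp c v f⟩ }
  suffices hW : W = ⊤ by
    have : w ∈ W := hW ▸ Submodule.mem_top
    exact this
  by_contra hW
  obtain ⟨φ, hφ, hle⟩ := Submodule.exists_le_ker_of_lt_top W (lt_top_iff_ne_top.mpr hW)
  let β : M →+ ((P₁ →ₗ[Bᵐᵒᵖ] B) →ₗ[k] k) :=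
    { toFun := fun m =>
        { toFun := fun h => φ (rankOneHom h m)
          map_add' := fun h h' => by
            rw [← map_add]
            congr 1
            ext p
            simp [rankOneHom, add_smul]
          map_smul' := fun c h => by
            rw [RingHom.id_apply, ← map_smul]
            congr 1
            ext p
            simp [rankOneHom] }
      map_zero' := by
        ext h
        change φ (rankOneHom h (0 : M)) = 0
        rw [← map_zero φ]
        congr 1
        ext p
        simp [rankOneHom]
      map_add' := fun m m' => by
        ext h
        change φ (rankOneHom h (m + m')) = φ (rankOneHom h m) + φ (rankOneHom h m')
        rw [← map_add]
        congr 1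
        ext p
        simp [rankOneHom] }
  have hβ : β = 0 := by
    refine hM P₁ P₀ f g hfg β (fun m b h => ?_) fun m g₀ => ?_
    · change φ _ = φ _
      congr 1
      ext p
      simp [rankOneHom, leftMulHom, mul_smul]
    · exact hle ⟨rankOneHom g₀ m, rfl⟩
  have := hfg.1
  obtain ⟨n, b, c, hbc⟩ := exists_dualBasis (R := Bᵐᵒᵖ) P₁
  let c' (i : Fin n) : P₁ →ₗ[Bᵐᵒᵖ] B :=
    { toFun := fun p => unop (c i p)
      map_add' := fun x y => by rw [map_add, MulOpposite.unop_add]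
      map_smul' := fun r p => by
        rw [map_smul, smul_eq_mul, unop_mul, RingHom.id_apply, MulOpposite.smul_eq_mul_unop] }
  refine hφ (LinearMap.ext fun w => ?_)
  have hw : w = ∑ i, rankOneHom (c' i) (w (b i)) := by
    ext p
    conv_lhs => rw [← hbc p, map_sum]
    rw [LinearMap.sum_apply]
    exact Finset.sum_congr rfl fun i _ => map_smul w _ _
  rw [hw, map_sum]
  refine Finset.sum_eq_zero fun i _ => ?_
  exact LinearMap.congr_fun (DFunLike.congr_fun hβ (w (b i))) (c' i)

theorem IsTauRigid.isExtProjFor [Module.Finite k B] {M : ModuleCat.{0} Bᵐᵒᵖ}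
    [Module.Finite Bᵐᵒᵖ M] (hM : IsTauRigid k B M) : IsExtProjFor Bᵐᵒᵖ M M := by
  have : Module.Finite k Bᵐᵒᵖ := Module.Finite.equiv (MulOpposite.opLinearEquiv k)
  obtain ⟨_, _⟩ := isNoetherian_and_isArtinian_of_finite_over_field k (R := Bᵐᵒᵖ) Bᵐᵒᵖ
  obtain ⟨P₀, _, _, g, _, _, hg, hg'⟩ := exists_projectiveCover (R := Bᵐᵒᵖ) M
  have : IsNoetherianRing Bᵐᵒᵖ := ‹_›
  obtain ⟨P₁, _, _, g₁, _, _, hg₁, hg₁'⟩ :=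
    exists_projectiveCover (R := Bᵐᵒᵖ) (LinearMap.ker g)
  have hrange : LinearMap.range ((LinearMap.ker g).subtype ∘ₗ g₁) = LinearMap.ker g := by
    rw [LinearMap.range_comp, LinearMap.range_eq_top.mpr hg₁, Submodule.map_top,
      Submodule.range_subtype]
  have hker : LinearMap.ker ((LinearMap.ker g).subtype ∘ₗ g₁) = LinearMap.ker g₁ := by
    rw [LinearMap.ker_comp, Submodule.ker_subtype, ← LinearMap.ker]
  refine isExtProjFor_self_of_presentation (f := (LinearMap.ker g).subtype ∘ₗ g₁) hg hrange
    fun w => ?_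
  exact IsTauRigid.exists_comp_eq k (P₁ := ModuleCat.of Bᵐᵒᵖ P₁) (P₀ := ModuleCat.of Bᵐᵒᵖ P₀) hM
    ⟨‹_›, ‹_›, hg, hrange, hg', by rw [hker]; exact hg₁'⟩ w

end TauRigid

section ChangeOfRings

variable {R S : Type} [Ring R] [Ring S] {N : Type} [AddCommGroup N] [Module R N] [Module S N]

/-- An `R`-linear map between modules over a quotient `S` of `R` is `S`-linear. -/
def LinearMap.extendScalarsAlong {π : R →+* S} (hπ : Function.Surjective π)
    (hN : ∀ (r : R) (x : N), π r • x = r • x) {E : Type} [AddCommGroup E] [Module R E] [Module S E]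
    (hE : ∀ (r : R) (x : E), π r • x = r • x) (f : N →ₗ[R] E) : N →ₗ[S] E where
  toFun := f
  map_add' := f.map_add
  map_smul' s x := by
    obtain ⟨r, rfl⟩ := hπ s
    rw [hN, map_smul, RingHom.id_apply, hE]

/-- Ext-projectivity over the quotient `S` of `R` by the two-sided ideal generated by an idempotent
`e` implies Ext-projectivity over `R`. -/
theorem IsExtProjFor.of_quotient {π : R →+* S} (hπ : Function.Surjective π) {e : R}
    (he : IsIdempotentElem e) (hπe : π e = 0)
    (hlift : ∀ (T : Type) [Ring T] (φ : R →+* T), φ e = 0 → RingHom.ker π ≤ RingHom.ker φ)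
    (hN : ∀ (r : R) (x : N), π r • x = r • x) (h : IsExtProjFor S N N) : IsExtProjFor R N N := by
  intro E Y _ _ _ _ p hp hker u
  have heN (x : N) : e • x = 0 := by rw [← hN, hπe, zero_smul]
  have heK (z : LinearMap.ker p) : e • z = 0 := by
    refine traceSubmodule_induction (P := fun z => e • z = 0) (hker z) (fun f y => ?_)
      fun x y hx hy => ?_
    · rw [← map_smul, heN, map_zero]
    · rw [smul_add, hx, hy, add_zero]
  let E' : Submodule R (E × N) :=
    LinearMap.ker (p ∘ₗ LinearMap.fst R E N - u ∘ₗ LinearMap.snd R E N)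
  have hE' (z : E') : p z.1.1 = u z.1.2 := sub_eq_zero.mp z.2
  have heE (z : E') : e • z = 0 := by
    have hmem : e • z.1.1 ∈ LinearMap.ker p := by
      rw [LinearMap.mem_ker, map_smul, hE', ← map_smul, heN, map_zero]
    have h0 : e • e • z.1.1 = 0 := congrArg Subtype.val (heK ⟨_, hmem⟩)
    rw [smul_smul, he.eq] at h0
    exact Subtype.ext (Prod.ext h0 (heN _))
  let φ : R →+* AddMonoid.End E' := Module.toAddMonoidEnd R E'
  have hφ : RingHom.ker π ≤ RingHom.ker φ := hlift _ φ (AddMonoidHom.ext heE)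
  let ψ : S →+* AddMonoid.End E' := RingHom.liftOfSurjective π hπ ⟨φ, hφ⟩
  let _ : Module S E' := Module.compHom E' ψ
  have hSE (r : R) (z : E') : π r • z = r • z :=
    DFunLike.congr_fun (RingHom.liftOfRightInverse_comp_apply π (Function.surjInv hπ)
      (Function.rightInverse_surjInv hπ)
      ⟨φ, hφ⟩ r) z
  let q : E' →ₗ[S] N := LinearMap.extendScalarsAlong hπ hSE hN (LinearMap.snd R E N ∘ₗ E'.subtype)
  have hq : Function.Surjective q := fun x => by
    obtain ⟨y, hy⟩ := hp (u x)
    exact ⟨⟨(y, x), sub_eq_zero.mpr hy⟩, rfl⟩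
  let j : LinearMap.ker p →ₗ[R] E' := (LinearMap.inl R E N ∘ₗ (LinearMap.ker p).subtype).codRestrict
    E' fun z => by simp [E']
  have hqker : IsGenBy S N (LinearMap.ker q) := by
    have hj (z : LinearMap.ker p) : ∃ hz : j z ∈ LinearMap.ker q,
        (⟨j z, hz⟩ : LinearMap.ker q) ∈ traceSubmodule (R := S) N (LinearMap.ker q) := by
      refine traceSubmodule_induction (P := fun z => ∃ hz : j z ∈ LinearMap.ker q,
        (⟨j z, hz⟩ : LinearMap.ker q) ∈ traceSubmodule (R := S) N (LinearMap.ker q)) (hker z)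
        (fun f y => ⟨rfl, ?_⟩) ?_
      · exact apply_mem_traceSubmodule (R := S) (X := LinearMap.ker q)
          ((LinearMap.extendScalarsAlong hπ hN hSE (j ∘ₗ f)).codRestrict (LinearMap.ker q)
            fun _ => rfl) y
      · rintro x y ⟨hx, hx'⟩ ⟨hy, hy'⟩
        have : (⟨j (x + y), rfl⟩ : LinearMap.ker q) = ⟨j x, hx⟩ + ⟨j y, hy⟩ :=
          Subtype.ext (map_add j x y)
        exact ⟨rfl, this ▸ add_mem hx' hy'⟩
    rintro ⟨⟨⟨z, x⟩, hzx⟩, hx⟩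
    obtain rfl : x = 0 := hx
    have hz : z ∈ LinearMap.ker p := by simpa using hE' ⟨(z, 0), hzx⟩
    exact (hj ⟨z, hz⟩).2
  obtain ⟨v, hv⟩ := h E' N q hq hqker LinearMap.id
  refine ⟨LinearMap.fst R E N ∘ₗ E'.subtype ∘ₗ
    LinearMap.extendScalarsAlong (π := RingHom.id R) Function.surjective_id (fun _ _ => rfl)
      (fun _ _ => rfl)
      { toFun := v, map_add' := v.map_add, map_smul' := fun r x => by
          rw [← hN, map_smul, hSE, RingHom.id_apply] }, LinearMap.ext fun x => ?_⟩
  have : q (v x) = x := LinearMap.congr_fun hv x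
  exact (hE' (v x)).trans (congrArg u this)

end ChangeOfRings

section SupportTauTilting

variable (k : Type) [Field k] {A : Type} [Ring A] [Algebra k A]

theorem IdemQuot.mk_surjective (e : A) : Function.Surjective (IdemQuot.mk A e) :=
  RingCon.mk'_surjective _

theorem IdemQuot.mk_eq_zero_iff (e x : A) :
    IdemQuot.mk A e x = 0 ↔ x ∈ TwoSidedIdeal.span {e} := by
  rw [TwoSidedIdeal.mem_iff, ← RingCon.eq]
  rfl

theorem IsSupportTauTilting.finite_and_isExtProjFor [Module.Finite k A] {M : ModuleCat.{0} Aᵐᵒᵖ}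
    (hM : IsSupportTauTilting k A M) : Module.Finite Aᵐᵒᵖ M ∧ IsExtProjFor Aᵐᵒᵖ M M := by
  obtain ⟨e, he, N, ⟨_, hN, -⟩, ⟨φ⟩⟩ := hM
  let _ : Module Aᵐᵒᵖ N := Module.compHom N (RingHom.op (IdemQuot.mk A e))
  let mkₗ : A →ₗ[k] IdemQuot A e :=
    { toFun := IdemQuot.mk A e
      map_add' := map_add _
      map_smul' := fun c x => by
        rw [Algebra.smul_def, map_mul, RingHom.id_apply, Algebra.smul_def]
        rfl }
  have : Module.Finite k (IdemQuot A e) :=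
    Module.Finite.of_surjective mkₗ (IdemQuot.mk_surjective e)
  have hπ : Function.Surjective (RingHom.op (IdemQuot.mk A e)) := fun y => by
    obtain ⟨x, hx⟩ := IdemQuot.mk_surjective e (unop y)
    exact ⟨op x, unop_injective hx⟩
  have hsmul (r : Aᵐᵒᵖ) (x : N) : RingHom.op (IdemQuot.mk A e) r • x = r • x := rfl
  have hfin : Module.Finite Aᵐᵒᵖ N := by
    obtain ⟨s, hs⟩ := Module.Finite.fg_top (R := (IdemQuot A e)ᵐᵒᵖ) (M := N)
    refine ⟨s, eq_top_iff.mpr fun x _ => ?_⟩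
    refine Submodule.span_induction (p := fun x _ => x ∈ Submodule.span Aᵐᵒᵖ (s : Set N))
      (fun x hx => Submodule.subset_span hx) (zero_mem _) (fun _ _ _ _ => add_mem) ?_
      (hs ▸ Submodule.mem_top : x ∈ Submodule.span (IdemQuot A e)ᵐᵒᵖ (s : Set N))
    intro c x _ hx
    obtain ⟨r, rfl⟩ := hπ c
    exact Submodule.smul_mem _ r hx
  have hext : IsExtProjFor Aᵐᵒᵖ N N := by
    refine IsExtProjFor.of_quotient hπ (e := op e) ?_ ?_ ?_ hsmul (hN.isExtProjFor k)
    · exact unop_injective he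
    · exact unop_injective
        ((IdemQuot.mk_eq_zero_iff e e).mpr (TwoSidedIdeal.subset_span (Set.mem_singleton e)))
    · intro T _ φ hφ r hr
      have hr' : unop r ∈ TwoSidedIdeal.span {e} :=
        (IdemQuot.mk_eq_zero_iff e _).mp (congrArg unop hr)
      let φ' : A →+* Tᵐᵒᵖ :=
        { toFun := fun a => op (φ (op a))
          map_one' := congrArg op (map_one φ)
          map_zero' := congrArg op (map_zero φ)
          map_add' := fun x y => congrArg op (map_add φ (op x) (op y))
          map_mul' := fun x y => congrArg op (map_mul φ (op y) (op x)) }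
      have hle : TwoSidedIdeal.span {e} ≤ TwoSidedIdeal.ker φ' :=
        TwoSidedIdeal.span_le.mpr (Set.singleton_subset_iff.mpr
          ((TwoSidedIdeal.mem_ker φ').mpr (congrArg op hφ)))
      exact congrArg unop ((TwoSidedIdeal.mem_ker φ').mp (hle hr'))
  exact ⟨Module.Finite.equiv φ.symm, (hext.mono (IsGenBy.self.congr_left φ)).congr φ.symm⟩

end SupportTauTilting

section CyclicBricks

/-- The relations satisfied by the idempotents `E i`, the sum `T` of the arrows of the cycle and
the loop `a` in the opposite of the algebra `Λ(m)`. -/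
structure IsLoopedCycle (k : Type) [Field k] {R : Type} [Ring R] [Algebra k R] (m : ℕ)
    (E : ZMod m → R) (T a : R) : Prop where
  idem (i : ZMod m) : E i * E i = E i
  orthogonal (i j : ZMod m) : i ≠ j → E i * E j = 0
  exists_sum_eq_one : ∃ s : Finset (ZMod m), ∑ i ∈ s, E i = 1
  idem_mul_cycle (i : ZMod m) : E (i + 1) * T = T * E i
  loop_mul_cycle : a * T = 0
  cycle_mul_loop : T * a = 0
  idem_mul_loop : E 0 * a = a
  loop_mul_idem : a * E 0 = a
  loop_mul_loop : a * a = T ^ (2 * m) * E 0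
  cycle_pow : T ^ (2 * m + 1) = 0
  adjoin_eq_top : Algebra.adjoin k (Set.range E ∪ {T, a}) = ⊤

/-- A nilpotent central element acts as zero on a brick. -/
theorem IsBrick.smul_eq_zero {R : Type} [Ring R] {Y : Type} [AddCommGroup Y] [Module R Y]
    (hY : IsBrick R Y) {z : R} (hz : ∀ r, r * z = z * r) (hnil : IsNilpotent z) (y : Y) :
    z • y = 0 := by
  let f : Module.End R Y :=
    { toFun := fun y => z • y
      map_add' := smul_add z
      map_smul' := fun r y => by rw [smul_smul, ← hz, mul_smul, RingHom.id_apply] }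
  have hf (n : ℕ) (y : Y) : (f ^ n) y = z ^ n • y := by
    induction n with
    | zero => simp
    | succ n ih => rw [pow_succ', Module.End.mul_apply, ih, pow_succ', mul_smul]; rfl
  by_contra hne
  have hinj : Function.Injective f := (hY.2 f fun h => hne (LinearMap.congr_fun h y)).1
  obtain ⟨n, hn⟩ := hnil
  have := hY.1
  obtain ⟨x, hx⟩ := exists_ne (0 : Y)
  refine hx (Module.End.iterate_injective hinj n ?_)
  rw [map_zero, hf, hn, zero_smul]

namespace IsLoopedCycle

variable {k : Type} [Field k] {R : Type} [Ring R] [Algebra k R] {m : ℕ} {E : ZMod m → R} {T a : R}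

theorem commute_of_generators (h : IsLoopedCycle k m E T a) {z : R} (hE : ∀ i, E i * z = z * E i)
    (hT : T * z = z * T) (ha : a * z = z * a) (r : R) : r * z = z * r := by
  have hle : Algebra.adjoin k (Set.range E ∪ {T, a}) ≤ Subalgebra.centralizer k {z} := by
    rw [Algebra.adjoin_le_iff]
    rintro _ (⟨i, rfl⟩ | rfl | rfl) <;> rintro _ rfl
    exacts [(hE i).symm, hT.symm, ha.symm]
  have hr : r ∈ Subalgebra.centralizer k {z} := hle (h.adjoin_eq_top ▸ Algebra.mem_top)
  exact (hr z rfl).symm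

theorem idem_mul_cycle_pow (h : IsLoopedCycle k m E T a) (i : ZMod m) (n : ℕ) :
    E (i + n) * T ^ n = T ^ n * E i := by
  induction n with
  | zero => simp
  | succ n ih =>
    rw [pow_succ', ← mul_assoc, Nat.cast_succ, ← add_assoc, h.idem_mul_cycle, mul_assoc, ih,
      mul_assoc]

theorem loop_smul_eq_zero (h : IsLoopedCycle k m E T a) (hm : 0 < m) {Y : Type} [AddCommGroup Y]
    [Module R Y] (hY : IsBrick R Y) (y : Y) : a • y = 0 := by
  refine hY.smul_eq_zero (h.commute_of_generators (fun i => ?_) ?_ rfl) ⟨3, ?_⟩ y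
  · by_cases hi : i = 0
    · rw [hi, h.idem_mul_loop, h.loop_mul_idem]
    · rw [← h.idem_mul_loop, ← mul_assoc, h.orthogonal _ _ hi, zero_mul, h.idem_mul_loop,
        ← h.loop_mul_idem, mul_assoc, h.orthogonal _ _ (Ne.symm hi), mul_zero]
  · rw [h.loop_mul_cycle, h.cycle_mul_loop]
  · rw [pow_succ, pow_two, h.loop_mul_loop, mul_assoc, h.idem_mul_loop,
      show 2 * m = (2 * m - 1) + 1 by omega, pow_succ, mul_assoc, h.cycle_mul_loop, mul_zero]

theorem cycle_pow_smul_eq_zero (h : IsLoopedCycle k m E T a) (hm : 0 < m) {Y : Type}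
    [AddCommGroup Y] [Module R Y] (hY : IsBrick R Y) (y : Y) : T ^ m • y = 0 := by
  refine hY.smul_eq_zero (h.commute_of_generators (fun i => ?_) ?_ ?_) ⟨3, ?_⟩ y
  · simpa using h.idem_mul_cycle_pow i m
  · rw [← pow_succ', ← pow_succ]
  · obtain ⟨n, rfl⟩ := Nat.exists_eq_add_of_lt hm
    rw [pow_succ', ← mul_assoc, h.loop_mul_cycle, zero_mul, ← pow_succ', pow_succ, mul_assoc,
      h.cycle_mul_loop, mul_zero]
  · rw [← pow_mul]
    exact pow_eq_zero_of_le (by omega) h.cycle_pow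

/-- If `Y` and `Y'` are killed by the loop and by `T ^ (l + 1)`, where `l < m`, then a vector
`x ∈ Y` at the vertex `v` with `T ^ l • x ≠ 0` can be mapped to any vector of `Y'` at the
vertex `v`. -/
theorem exists_apply_eq (h : IsLoopedCycle k m E T a) {l : ℕ} (hl : l < m) (v : ZMod m)
    {Y Y' : Type} [AddCommGroup Y] [Module R Y] [AddCommGroup Y'] [Module R Y']
    (haY : ∀ y : Y, a • y = 0) (haY' : ∀ y : Y', a • y = 0) (hTY : ∀ y : Y, T ^ (l + 1) • y = 0)
    (hTY' : ∀ y : Y', T ^ (l + 1) • y = 0) {x : Y} (hx : E v • x = x) (hx0 : T ^ l • x ≠ 0)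
    {x' : Y'} (hx' : E v • x' = x') : ∃ θ : Y →ₗ[R] Y', θ x = x' := by
  let _ : Module k Y := Module.compHom Y (algebraMap k R)
  have : IsScalarTower k R Y := IsScalarTower.of_compHom k R Y
  let _ : Module k Y' := Module.compHom Y' (algebraMap k R)
  have : IsScalarTower k R Y' := IsScalarTower.of_compHom k R Y'
  have : SMulCommClass R k Y := IsScalarTower.to_smulCommClass'
  have : SMulCommClass R k Y' := IsScalarTower.to_smulCommClass'
  obtain ⟨φ, hφ⟩ : ∃ φ : Module.Dual k Y, φ (T ^ l • x) ≠ 0 := by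
    by_contra! hcon
    exact hx0 ((Module.forall_dual_apply_eq_zero_iff k _).mp hcon)
  let θ : Y →ₗ[k] Y' := ∑ i ∈ Finset.range (l + 1),
    (φ ∘ₗ Module.toModuleEnd k (S := R) Y (T ^ (l - i) * E (v + i))).smulRight (T ^ i • x')
  have hθ (y : Y) : θ y = ∑ i ∈ Finset.range (l + 1),
      φ ((T ^ (l - i) * E (v + i)) • y) • (T ^ i • x') := by
    simp [θ, LinearMap.sum_apply]
  have hlin (r : R) : ∀ y, θ (r • y) = r • θ y := by
    refine Algebra.adjoin_induction (p := fun r _ => ∀ y, θ (r • y) = r • θ y) ?_ (fun c y => ?_)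
      (fun r s _ _ hr hs y => ?_) (fun r s _ _ hr hs y => ?_)
      (h.adjoin_eq_top ▸ Algebra.mem_top : r ∈ Algebra.adjoin k (Set.range E ∪ {T, a}))
    · rintro s (⟨j, rfl⟩ | hs | hs) y
      · rw [hθ, hθ, Finset.smul_sum]
        refine Finset.sum_congr rfl fun i _ => ?_
        have hi : E (v + i) • T ^ i • x' = T ^ i • x' := by
          rw [smul_smul, h.idem_mul_cycle_pow, mul_smul, hx']
        rw [smul_smul, mul_assoc, smul_comm (E j)]
        by_cases hj : j = v + i
        · rw [hj, h.idem, hi]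
        · rw [← hi, smul_smul (E j), h.orthogonal _ _ hj, h.orthogonal _ _ (Ne.symm hj), mul_zero,
            zero_smul, zero_smul, map_zero, zero_smul, smul_zero]
      · rw [show s = T from hs, hθ, hθ, Finset.smul_sum, Finset.sum_range_succ',
          Finset.sum_range_succ]
        congr 1
        · refine Finset.sum_congr rfl fun i hi => ?_
          have hi' : l - i = l - (i + 1) + 1 := by
            have := Finset.mem_range.mp hi
            omega
          rw [smul_smul, mul_assoc, Nat.cast_succ, ← add_assoc, h.idem_mul_cycle, ← mul_assoc,
            ← pow_succ, ← hi', smul_comm T, smul_smul T, ← pow_succ']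
        · rw [smul_smul, mul_assoc, smul_comm T, smul_smul T, ← pow_succ', hTY', smul_zero]
          have : E (v + (0 : ℕ)) * T = T * E (v - 1) := by
            rw [← h.idem_mul_cycle]
            simp
          rw [this, ← mul_assoc, ← pow_succ, mul_smul, Nat.sub_zero, hTY, map_zero, zero_smul]
      · rw [show s = a from hs, haY, haY', map_zero]
    · rw [algebraMap_smul, algebraMap_smul, map_smul]
    · rw [add_smul, map_add, hr, hs, add_smul]
    · rw [mul_smul, hr, hs, mul_smul]
  refine ⟨{ toFun := fun y => θ ((φ (T ^ l • x))⁻¹ • y)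
            map_add' := fun y z => by rw [smul_add, map_add]
            map_smul' := fun r y => by rw [← smul_comm r, hlin, RingHom.id_apply] }, ?_⟩
  change θ ((φ (T ^ l • x))⁻¹ • x) = x'
  rw [map_smul, hθ, Finset.sum_eq_single 0]
  · simp only [Nat.sub_zero, Nat.cast_zero, add_zero, pow_zero, one_smul]
    rw [mul_smul, hx, smul_smul, inv_mul_cancel₀ hφ, one_smul]
  · intro i hi hi0
    have hne : v + i ≠ v := by
      intro hcon
      have : (i : ZMod m) = 0 := by simpa using hcon
      rw [ZMod.natCast_eq_zero_iff] at this
      have := Nat.le_of_dvd (Nat.pos_of_ne_zero hi0) this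
      have := Finset.mem_range.mp hi
      omega
    rw [← hx, smul_smul, mul_assoc, h.orthogonal _ _ hne, mul_zero, zero_smul, map_zero, zero_smul]
  · simp

variable (k R m E T a) in
/-- A brick on which `T ^ (l + 1)` vanishes, but `T ^ l` does not vanish at the vertex `v`. -/
def IsBrickOfType (v : ZMod m) (l : ℕ) (Y : Type) [AddCommGroup Y] [Module R Y] : Prop :=
  IsBrick R Y ∧ (∀ y : Y, T ^ (l + 1) • y = 0) ∧ ∃ x : Y, E v • x = x ∧ T ^ l • x ≠ 0

theorem exists_isBrickOfType (h : IsLoopedCycle k m E T a) (hm : 0 < m) {Y : Type}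
    [AddCommGroup Y] [Module R Y] (hY : IsBrick R Y) :
    ∃ (v : ZMod m) (l : Fin m), IsBrickOfType R m E T v l Y := by
  classical
  have hex : ∃ n, ∀ y : Y, T ^ n • y = 0 := ⟨m, h.cycle_pow_smul_eq_zero hm hY⟩
  have hle : Nat.find hex ≤ m := Nat.find_min' hex (h.cycle_pow_smul_eq_zero hm hY)
  have hpos : Nat.find hex ≠ 0 := by
    have := hY.1
    obtain ⟨y, hy⟩ := exists_ne (0 : Y)
    intro h0
    have := Nat.find_spec hex y
    rw [h0, pow_zero, one_smul] at this
    exact hy this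
  obtain ⟨l, hl⟩ := Nat.exists_eq_succ_of_ne_zero hpos
  have hnot := Nat.find_min hex (show l < Nat.find hex by omega)
  push Not at hnot
  obtain ⟨y, hy⟩ := hnot
  obtain ⟨s, hs⟩ := h.exists_sum_eq_one
  obtain ⟨v, hv⟩ : ∃ v, T ^ l • E v • y ≠ 0 := by
    by_contra! hcon
    apply hy
    rw [← one_smul R y, ← hs, Finset.sum_smul, Finset.smul_sum]
    exact Finset.sum_eq_zero fun v _ => hcon v
  refine ⟨v, ⟨l, by omega⟩, hY, fun y => ?_, E v • y, by rw [smul_smul, h.idem], hv⟩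
  have := Nat.find_spec hex y
  rwa [hl] at this

theorem nonempty_linearEquiv (h : IsLoopedCycle k m E T a) {v : ZMod m} {l : Fin m} {Y Y' : Type}
    [AddCommGroup Y] [Module R Y] [AddCommGroup Y'] [Module R Y']
    (hY : IsBrickOfType R m E T v l Y) (hY' : IsBrickOfType R m E T v l Y') :
    Nonempty (Y ≃ₗ[R] Y') := by
  have hm : 0 < m := l.pos
  obtain ⟨hY, hT, x, hx, hx0⟩ := hY
  obtain ⟨hY', hT', x', hx', hx0'⟩ := hY'
  have ha := h.loop_smul_eq_zero hm hY
  have ha' := h.loop_smul_eq_zero hm hY'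
  obtain ⟨θ, hθ⟩ := h.exists_apply_eq l.2 v ha ha' hT hT' hx hx0 hx'
  obtain ⟨θ', hθ'⟩ := h.exists_apply_eq l.2 v ha' ha hT' hT hx' hx0' hx
  have h1 : Function.Bijective (θ' ∘ₗ θ) := hY.2 _ fun hcon => hx0 (by
    have : θ' (θ x) = 0 := LinearMap.congr_fun hcon x
    rw [hθ, hθ'] at this
    rw [this, smul_zero])
  have h2 : Function.Bijective (θ ∘ₗ θ') := hY'.2 _ fun hcon => hx0' (by
    have : θ (θ' x') = 0 := LinearMap.congr_fun hcon x'
    rw [hθ', hθ] at this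
    rw [this, smul_zero])
  exact ⟨LinearEquiv.ofBijective θ
    ⟨Function.Injective.of_comp (f := θ') h1.1, Function.Surjective.of_comp (g := θ') h2.2⟩⟩

/-- Up to isomorphism there are only finitely many bricks. -/
theorem exists_finite_bricks (h : IsLoopedCycle k m E T a) (hm : 0 < m) :
    ∃ (n : ℕ) (S : Fin n → ModuleCat.{0} R), ∀ (Y : Type) [AddCommGroup Y] [Module R Y],
      IsBrick R Y → ∃ i, Nonempty (Y ≃ₗ[R] S i) := by
  have : NeZero m := ⟨hm.ne'⟩
  have hS (p : ZMod m × Fin m) : ∃ S : ModuleCat.{0} R, ∀ (Y : Type) [AddCommGroup Y]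
      [Module R Y], IsBrickOfType R m E T p.1 p.2 Y → Nonempty (Y ≃ₗ[R] S) := by
    by_cases hp : ∃ (X : Type) (_ : AddCommGroup X) (_ : Module R X),
        IsBrickOfType R m E T p.1 p.2 X
    · obtain ⟨X, _, _, hX⟩ := hp
      exact ⟨ModuleCat.of R X, fun Y _ _ hY => h.nonempty_linearEquiv hY hX⟩
    · exact ⟨ModuleCat.of R PUnit, fun Y _ _ hY => absurd ⟨Y, _, _, hY⟩ hp⟩
  choose S hS using hS
  obtain ⟨n, ⟨e⟩⟩ := Finite.exists_equiv_fin (ZMod m × Fin m)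
  refine ⟨n, fun i => S (e.symm i), fun Y _ _ hY => ?_⟩
  obtain ⟨v, l, hvl⟩ := h.exists_isBrickOfType hm hY
  refine ⟨e (v, l), ?_⟩
  change Nonempty (Y ≃ₗ[R] S (e.symm (e (v, l))))
  rw [e.symm_apply_apply]
  exact hS (v, l) Y hvl

theorem module_finite (h : IsLoopedCycle k m E T a) (hm : 0 < m) : Module.Finite k R := by
  have : NeZero m := ⟨hm.ne'⟩
  set F : Set R := Set.range (fun p : Fin (2 * m + 1) × ZMod m => T ^ (p.1 : ℕ) * E p.2) ∪ {a}
    with hF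
  have hmem (l : ℕ) (i : ZMod m) : T ^ l * E i ∈ Submodule.span k F := by
    by_cases hl : l < 2 * m + 1
    · exact Submodule.subset_span (Or.inl ⟨(⟨l, hl⟩, i), rfl⟩)
    · rw [pow_eq_zero_of_le (by omega) h.cycle_pow, zero_mul]
      exact zero_mem _
  have ha : a ∈ Submodule.span k F := Submodule.subset_span (Or.inr rfl)
  have hgen (g : R) (hg : g ∈ Set.range E ∪ {T, a}) (y : R) (hy : y ∈ F) :
      g * y ∈ Submodule.span k F := by
    rcases hg with ⟨j, rfl⟩ | hg | hg <;> rcases hy with ⟨⟨l, i⟩, rfl⟩ | hy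
    · dsimp only
      rw [← h.idem_mul_cycle_pow, ← mul_assoc]
      by_cases hj : j = i + (l : ℕ)
      · rw [hj, h.idem, h.idem_mul_cycle_pow]
        exact hmem _ _
      · rw [h.orthogonal _ _ hj, zero_mul]
        exact zero_mem _
    · rw [show y = a from hy, ← h.idem_mul_loop, ← mul_assoc]
      by_cases hj : j = 0
      · rw [hj, h.idem, h.idem_mul_loop]
        exact ha
      · rw [h.orthogonal _ _ hj, zero_mul]
        exact zero_mem _
    · rw [show g = T from hg, ← mul_assoc, ← pow_succ']
      exact hmem _ _
    · rw [show g = T from hg, show y = a from hy, h.cycle_mul_loop]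
      exact zero_mem _
    · rw [show g = a from hg]
      dsimp only
      rcases Nat.eq_zero_or_pos (l : ℕ) with hl | hl
      · rw [hl, pow_zero, one_mul, ← h.loop_mul_idem, mul_assoc]
        by_cases hi : 0 = i
        · rw [← hi, h.idem, h.loop_mul_idem]
          exact ha
        · rw [h.orthogonal _ _ hi, mul_zero]
          exact zero_mem _
      · rw [← Nat.sub_add_cancel hl, pow_succ', mul_assoc, ← mul_assoc, h.loop_mul_cycle, zero_mul]
        exact zero_mem _
    · rw [show g = a from hg, show y = a from hy, h.loop_mul_loop]
      exact hmem _ _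
  have hmul (r : R) : ∀ y ∈ Submodule.span k F, r * y ∈ Submodule.span k F := by
    refine Algebra.adjoin_induction
      (p := fun r _ => ∀ y ∈ Submodule.span k F, r * y ∈ Submodule.span k F)
      (fun g hg y hy => ?_) (fun c y hy => ?_) (fun r s _ _ hr hs y hy => ?_)
      (fun r s _ _ hr hs y hy => ?_)
      (h.adjoin_eq_top ▸ Algebra.mem_top : r ∈ Algebra.adjoin k (Set.range E ∪ {T, a}))
    · refine Submodule.span_induction (p := fun y _ => g * y ∈ Submodule.span k F)
        (fun y hy => hgen g hg y hy) (by simp) (fun _ _ _ _ hx hy => ?_) (fun c _ _ hx => ?_) hy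
      · rw [mul_add]
        exact add_mem hx hy
      · rw [mul_smul_comm]
        exact Submodule.smul_mem _ c hx
    · rw [← Algebra.smul_def]
      exact Submodule.smul_mem _ c hy
    · rw [add_mul]
      exact add_mem (hr y hy) (hs y hy)
    · rw [mul_assoc]
      exact hr _ (hs y hy)
  have hone : (1 : R) ∈ Submodule.span k F := by
    obtain ⟨s, hs⟩ := h.exists_sum_eq_one
    rw [← hs]
    exact sum_mem fun i _ => by simpa using hmem 0 i
  refine Module.Finite.of_fg_top ⟨(Set.Finite.toFinset (s := F) ?_), ?_⟩
  · exact (Set.finite_range _).union (Set.finite_singleton a)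
  · rw [Set.Finite.coe_toFinset, eq_top_iff]
    rintro r -
    simpa using hmul r 1 hone

end IsLoopedCycle

end CyclicBricks

section Presentation

variable (k : Type) [Field k]

namespace BoundQuiverAlg

variable {V Q : Type} [Fintype V] [DecidableEq V] (s t : Q → V)
  (extra : FreeAlgebra k (V ⊕ Q) → FreeAlgebra k (V ⊕ Q) → Prop)

/-- The projection from the free algebra to a bound quiver algebra. -/
def mk : FreeAlgebra k (V ⊕ Q) →ₐ[k] BoundQuiverAlg k s t extra :=
  RingQuot.mkAlgHom k (quivRel k s t extra)

/-- The idempotent at a vertex. -/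
def vertex (v : V) : BoundQuiverAlg k s t extra := mk k s t extra (FreeAlgebra.ι k (Sum.inl v))

/-- The residue class of an arrow. -/
def arrow (b : Q) : BoundQuiverAlg k s t extra := mk k s t extra (FreeAlgebra.ι k (Sum.inr b))

variable {k s t extra}

theorem mk_eq_mk {x y : FreeAlgebra k (V ⊕ Q)} (h : quivRel k s t extra x y) :
    mk k s t extra x = mk k s t extra y :=
  RingQuot.mkAlgHom_rel k h

theorem mk_eq_mk_of_extra {x y : FreeAlgebra k (V ⊕ Q)} (h : extra x y) :
    mk k s t extra x = mk k s t extra y :=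
  mk_eq_mk (Or.inr (Or.inr (Or.inr (Or.inr h))))

theorem vertex_mul_vertex (v w : V) :
    vertex k s t extra v * vertex k s t extra w = if v = w then vertex k s t extra v else 0 := by
  rw [vertex, vertex, ← map_mul, mk_eq_mk (Or.inl ⟨v, w, rfl, rfl⟩)]
  split_ifs <;> simp

theorem sum_vertex : ∑ v, vertex k s t extra v = 1 := by
  have := mk_eq_mk (k := k) (s := s) (t := t) (extra := extra) (Or.inr (Or.inl ⟨rfl, rfl⟩))
  rwa [map_sum, map_one] at this

theorem vertex_mul_arrow (b : Q) :
    vertex k s t extra (s b) * arrow k s t extra b = arrow k s t extra b := by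
  rw [vertex, arrow, ← map_mul]
  exact mk_eq_mk (Or.inr (Or.inr (Or.inl ⟨b, rfl, rfl⟩)))

theorem arrow_mul_vertex (b : Q) :
    arrow k s t extra b * vertex k s t extra (t b) = arrow k s t extra b := by
  rw [vertex, arrow, ← map_mul]
  exact mk_eq_mk (Or.inr (Or.inr (Or.inr (Or.inl ⟨b, rfl, rfl⟩))))

theorem mk_arrWord (l : List Q) :
    mk k s t extra (arrWord k l) = (l.map (arrow k s t extra)).prod := by
  rw [arrWord, map_list_prod, List.map_map]
  rfl

variable (k s t extra) in
theorem adjoin_eq_top :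
    Algebra.adjoin k (Set.range (vertex k s t extra) ∪ Set.range (arrow k s t extra)) = ⊤ := by
  have hsurj : (mk k s t extra).range = ⊤ :=
    AlgHom.range_eq_top _ |>.mpr (RingQuot.mkAlgHom_surjective k _)
  rw [eq_top_iff, ← hsurj, ← Algebra.map_top, ← FreeAlgebra.adjoin_range_ι, AlgHom.map_adjoin]
  refine Algebra.adjoin_mono ?_
  rintro _ ⟨_, ⟨v | b, rfl⟩, rfl⟩
  exacts [Or.inl ⟨v, rfl⟩, Or.inr ⟨b, rfl⟩]

end BoundQuiverAlg

theorem cycVR_injective (p q : ℕ) : Function.Injective (cycVR p q) := by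
  let f : Option ({i : ZMod p // i ≠ 0} ⊕ {j : ZMod q // j ≠ 0}) → ZMod q :=
    fun x => x.elim 0 (Sum.elim (fun _ => 0) Subtype.val)
  refine Function.LeftInverse.injective (g := f) fun j => ?_
  by_cases hj : j = 0
  · exact (congrArg f (dif_pos hj)).trans hj.symm
  · exact congrArg f (dif_neg hj)

theorem cycVL_one_eq_cycVR (q : ℕ) (i : ZMod 1) : cycVL 1 q i = cycVR 1 q 0 := by
  have hL : cycVL 1 q i = (none : Option _) := dif_pos (Subsingleton.elim i 0)
  have hR : cycVR 1 q 0 = (none : Option _) := dif_pos rfl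
  exact hL.trans hR.symm

theorem cycVR_surjective (q : ℕ) : Function.Surjective (cycVR 1 q) := by
  rintro (_ | ⟨i, hi⟩ | ⟨j, hj⟩)
  · exact ⟨0, dif_pos rfl⟩
  · exact absurd (Subsingleton.elim i 0) hi
  · exact ⟨j, dif_neg hj⟩

variable (m : ℕ) [NeZero m]

open BoundQuiverAlg in
theorem exists_isLoopedCycle (hm : 2 ≤ m) :
    ∃ (E : ZMod m → (BoundQuiverAlg k (cycSrc 1 m) (cycTgt 1 m) (LamRelExtra k m))ᵐᵒᵖ)
      (T a : (BoundQuiverAlg k (cycSrc 1 m) (cycTgt 1 m) (LamRelExtra k m))ᵐᵒᵖ),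
      IsLoopedCycle k m E T a := by
  let B := BoundQuiverAlg k (cycSrc 1 m) (cycTgt 1 m) (LamRelExtra k m)
  let e (i : ZMod m) : B := vertex k _ _ _ (cycVR 1 m i)
  let b (i : ZMod m) : B := arrow k _ _ _ (Sum.inr i : CycE 1 m)
  let a : B := arrow k _ _ _ (Sum.inl 0 : CycE 1 m)
  let β : B := ∑ i, b i
  have hee (i j : ZMod m) (hij : i ≠ j) : e i * e j = 0 :=
    (vertex_mul_vertex _ _).trans (if_neg fun h => hij (cycVR_injective _ _ h))
  have hidem (i : ZMod m) : e i * e i = e i := (vertex_mul_vertex _ _).trans (if_pos rfl)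
  have hsum : ∑ i, e i = 1 := by
    refine Eq.trans ?_ sum_vertex
    exact Function.Bijective.sum_comp ⟨cycVR_injective 1 m, cycVR_surjective m⟩
      (vertex k (cycSrc 1 m) (cycTgt 1 m) (LamRelExtra k m))
  have heb (i : ZMod m) : e i * b i = b i := vertex_mul_arrow (Sum.inr i : CycE 1 m)
  have hbe (i : ZMod m) : b i * e (i + 1) = b i := arrow_mul_vertex (Sum.inr i : CycE 1 m)
  have hea : e 0 * a = a := by
    have := vertex_mul_arrow (k := k) (s := cycSrc 1 m) (t := cycTgt 1 m)
      (extra := LamRelExtra k m) (Sum.inl 0)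
    rwa [cycSrc, cycVL_one_eq_cycVR] at this
  have hae : a * e 0 = a := by
    have := arrow_mul_vertex (k := k) (s := cycSrc 1 m) (t := cycTgt 1 m)
      (extra := LamRelExtra k m) (Sum.inl 0)
    rwa [cycTgt, cycVL_one_eq_cycVR] at this
  have heβ (i : ZMod m) : e i * β = b i := by
    rw [Finset.mul_sum, Finset.sum_eq_single i _ (by simp), heb]
    intro j _ hj
    rw [← heb, ← mul_assoc, hee i j hj.symm, zero_mul]
  have hβe (i : ZMod m) : β * e (i + 1) = b i := by
    rw [Finset.sum_mul, Finset.sum_eq_single i _ (by simp), hbe]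
    intro j _ hj
    rw [← hbe, mul_assoc, hee _ _ (fun h => hj (add_right_cancel h)), mul_zero]
  have hcomm (i : ZMod m) (n : ℕ) : e i * β ^ n = β ^ n * e (i + n) := by
    induction n with
    | zero => simp
    | succ n ih =>
      rw [pow_succ, ← mul_assoc, ih, mul_assoc, heβ, ← hβe, Nat.cast_succ, ← mul_assoc, add_assoc]
  have hconcat (i j : ZMod m) (n l : ℕ) (hj : j = i + n) :
      e i * β ^ n * (e j * β ^ l) = e i * β ^ (n + l) := by
    rw [hj, mul_assoc, ← mul_assoc (β ^ n), ← hcomm, mul_assoc, ← pow_add, ← mul_assoc, hidem]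
  have hword (st n : ℕ) : mk k _ _ (LamRelExtra k m) (arrWord k (bw 1 m st (n + 1))) =
      e (st : ℕ) * β ^ (n + 1) := by
    have hprod : ((List.range (n + 1)).map fun u => b ((st + u : ℕ) : ZMod m)).prod =
        e (st : ℕ) * β ^ (n + 1) := by
      induction n with
      | zero => simp [heβ]
      | succ n ih =>
        rw [List.range_succ, List.map_append, List.prod_append, ih, List.map_singleton,
          List.prod_singleton, ← heβ, Nat.cast_add]
        simpa using hconcat st _ (n + 1) 1 rfl
    rw [mk_arrWord, ← hprod]
    exact congrArg List.prod List.map_map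
  have hmul (l l' : List (CycE 1 m)) :
      arrWord k (V := CycV 1 m) (l ++ l') = arrWord k l * arrWord k l' := by
    simp [arrWord]
  have hloop : mk k _ _ (LamRelExtra k m) (arrWord k (aw 1 m 0 1)) = a := by
    rw [mk_arrWord]
    exact mul_one a
  have hfull : mk k _ _ (LamRelExtra k m) (arrWord k (bw 1 m 0 m)) = e 0 * β ^ m := by
    obtain ⟨n, rfl⟩ := Nat.exists_eq_succ_of_ne_zero (NeZero.ne m)
    simpa using hword 0 n
  have haa : a * a = e 0 * β ^ (2 * m) := by
    have := mk_eq_mk_of_extra (s := cycSrc 1 m) (t := cycTgt 1 m) (extra := LamRelExtra k m)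
      (Or.inl ⟨rfl, rfl⟩)
    rw [hmul, hmul, map_mul, map_mul, hloop, hfull, hconcat _ _ _ _ (by simp)] at this
    rw [this, two_mul]
  have haβ : a * β = 0 := by
    have := mk_eq_mk_of_extra (s := cycSrc 1 m) (t := cycTgt 1 m) (extra := LamRelExtra k m)
      (Or.inr (Or.inl ⟨rfl, rfl⟩))
    rw [hmul, map_mul, hloop, hword 0 0, map_zero] at this
    simpa [← mul_assoc, hae] using this
  have hβa : β * a = 0 := by
    have := mk_eq_mk_of_extra (s := cycSrc 1 m) (t := cycTgt 1 m) (extra := LamRelExtra k m)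
      (Or.inr (Or.inr (Or.inl ⟨rfl, rfl⟩)))
    rw [hmul, map_mul, hloop, hword (m - 1) 0, map_zero, hcomm] at this
    have h0 : ((m - 1 : ℕ) : ZMod m) + ((0 + 1 : ℕ) : ZMod m) = 0 := by
      rw [← Nat.cast_add, Nat.zero_add, Nat.sub_add_cancel (by omega), ZMod.natCast_self]
    rw [h0, mul_assoc, hea, zero_add, pow_one] at this
    exact this
  have hvan (i : ZMod m) : e i * β ^ (2 * m + 1) = 0 := by
    obtain ⟨n, hn, rfl⟩ : ∃ n < m, (n : ZMod m) = i := ⟨i.val, i.val_lt, i.natCast_zmod_val⟩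
    rcases Nat.eq_zero_or_pos n with rfl | hpos
    · rw [Nat.cast_zero, pow_succ, ← mul_assoc, ← haa, mul_assoc, haβ, mul_zero]
    · by_cases hlast : n + 1 = m
      · have h0 : ((n : ℕ) : ZMod m) + ((1 : ℕ) : ZMod m) = 0 := by
          rw [← Nat.cast_add, hlast, ZMod.natCast_self]
        rw [add_comm, pow_add, ← mul_assoc, hcomm, h0, mul_assoc, ← haa, pow_one, ← mul_assoc, hβa,
          zero_mul]
      · have := mk_eq_mk_of_extra (s := cycSrc 1 m) (t := cycTgt 1 m) (extra := LamRelExtra k m)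
          (Or.inr (Or.inr (Or.inr ⟨n + 1, by omega, by omega, rfl, rfl⟩)))
        rw [hmul, hmul, map_mul, map_mul, hfull, hword, hword, map_zero, Nat.add_sub_cancel,
          hconcat _ _ _ _ (by
            rw [← Nat.cast_add, show n + (m - (n + 1) + 1) = m by omega, ZMod.natCast_self]),
          hconcat _ _ _ _ (by
            rw [← Nat.cast_add, show n + (m - (n + 1) + 1 + m) = m + m by omega]
            simp), show m - (n + 1) + 1 + m + (n + 1) = 2 * m + 1 by omega] at this
        exact this
  have hpow : β ^ (2 * m + 1) = 0 := by
    rw [← one_mul (β ^ (2 * m + 1)), ← hsum, Finset.sum_mul]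
    exact Finset.sum_eq_zero fun i _ => hvan i
  have hadj : Algebra.adjoin k (Set.range e ∪ {β, a}) = ⊤ := by
    rw [eq_top_iff, ← BoundQuiverAlg.adjoin_eq_top, Algebra.adjoin_le_iff]
    rintro _ (⟨v, rfl⟩ | ⟨i | i, rfl⟩)
    · obtain ⟨i, rfl⟩ := cycVR_surjective m v
      exact Algebra.subset_adjoin (Or.inl ⟨i, rfl⟩)
    · obtain rfl : i = 0 := Subsingleton.elim _ _
      exact Algebra.subset_adjoin (Or.inr (Or.inr rfl))
    · change b i ∈ _
      rw [← heβ]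
      exact mul_mem (Algebra.subset_adjoin (Or.inl ⟨i, rfl⟩))
        (Algebra.subset_adjoin (Or.inr (Or.inl rfl)))
  refine ⟨fun i => op (e i), op β, op a, ?_⟩
  refine
    { idem := fun i => congrArg op (hidem i)
      orthogonal := fun i j hij => congrArg op (hee j i hij.symm)
      exists_sum_eq_one := ⟨Finset.univ, ?_⟩
      idem_mul_cycle := fun i => congrArg op ((hβe i).trans (heβ i).symm)
      loop_mul_cycle := congrArg op hβa
      cycle_mul_loop := congrArg op haβ
      idem_mul_loop := congrArg op hae
      loop_mul_idem := congrArg op hea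
      loop_mul_loop := ?_
      cycle_pow := ?_
      adjoin_eq_top := ?_ }
  · rw [← Finset.op_sum, hsum, MulOpposite.op_one]
  · rw [← MulOpposite.op_mul, haa, MulOpposite.op_mul, MulOpposite.op_pow]
  · rw [← MulOpposite.op_pow, hpow, MulOpposite.op_zero]
  · have := congrArg Subalgebra.op hadj
    rw [Subalgebra.op_adjoin, Subalgebra.op_top] at this
    rw [← this]
    congr 1
    ext x
    constructor
    · rintro (⟨i, rfl⟩ | rfl | rfl)
      exacts [Or.inl ⟨i, rfl⟩, Or.inr (Or.inl rfl), Or.inr (Or.inr rfl)]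
    · rintro (⟨i, hi⟩ | hx | hx)
      exacts [Or.inl ⟨i, unop_injective hi⟩, Or.inr (Or.inl (unop_injective hx)),
        Or.inr (Or.inr (unop_injective hx))]

end Presentation

theorem IsLoopedCycle.tauTiltingFinite {k A : Type} [Field k] [Ring A] [Algebra k A] {m : ℕ}
    {E : ZMod m → Aᵐᵒᵖ} {T a : Aᵐᵒᵖ} (h : IsLoopedCycle k m E T a) (hm : 0 < m) :
    TauTiltingFinite k A := by
  have := h.module_finite hm
  have : Module.Finite k A := Module.Finite.equiv (MulOpposite.opLinearEquiv k).symm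
  obtain ⟨n, S, hS⟩ := h.exists_finite_bricks hm
  obtain ⟨κ, _, W, hW⟩ := exists_finite_isExtProjFor_self k Aᵐᵒᵖ S fun Y _ _ _ => hS Y
  obtain ⟨r, ⟨f⟩⟩ := Finite.exists_equiv_fin κ
  refine ⟨r, W ∘ f.symm, fun M hM hbasic => ?_⟩
  obtain ⟨_, hproj⟩ := hM.finite_and_isExtProjFor k
  obtain ⟨i, hi⟩ := hW M hproj fun L C _ _ _ _ hLC =>
    hbasic (ModuleCat.of Aᵐᵒᵖ L) (ModuleCat.of Aᵐᵒᵖ C) hLC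
  exact ⟨f i, by rwa [Function.comp_apply, f.symm_apply_apply]⟩

/-- For every `m ≥ 2`, the algebra `Λ(m)` is τ-tilting finite. -/
theorem statement14 (k : Type) [Field k] [IsAlgClosed k]
    (m : ℕ) (hm : 2 ≤ m) :
    TauTiltingFinite k (LamAlg k m (by omega)) := by
  have : NeZero m := ⟨by omega⟩
  obtain ⟨E, T, a, h⟩ := exists_isLoopedCycle k m hm
  exact IsLoopedCycle.tauTiltingFinite (A := LamAlg k m (by omega)) h (by omega)

end
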